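/- Let P = P_{n,r} be the poset of r-colored injective words with the natural 𝔖_n-action, let S = {s_1 < ⋯ < s_k} ⊆ {1,…,n−1} and let λ be a partition of n. Then the multiplicity b_{r,λ}(S) of ρ^λ in β_P(S) is equal to the number of pairs (w,Q) where w ∈ 𝔖_n has descent set S, Q is an r-colored standard Young tableau of shape λ, and τ(w,Q) is odd. -/

import Mathlib

open scoped Classical

noncomputable section

/-! ### Permutation combinatorics -/

/-- The value `w(i)` (1-based, in `{1,…,n}`) of a permutation `w` of `{1,…,n}`,
realized as `Equiv.Perm (Fin n)`. -/
def permApp {n : ℕ} (w : Equiv.Perm (Fin n)) (i : ℕ) : ℕ :=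
  if h : i - 1 < n then (w ⟨i - 1, h⟩ : ℕ) + 1 else 0

/-- The descent set of a permutation, a subset of `{1,…,n-1}`. -/
def descentSet {n : ℕ} (w : Equiv.Perm (Fin n)) : Finset ℕ :=
  (Finset.Icc 1 (n - 1)).filter fun i => permApp w (i + 1) < permApp w i

/-- `numDescentSet m T` is the number of permutations in `𝔖_m` with descent set `T`. -/
def numDescentSet (m : ℕ) (T : Finset ℕ) : ℕ :=
  Nat.card {w : Equiv.Perm (Fin m) // descentSet w = T}

/-- The Coxeter length (number of inversions) of a permutation. -/
def invCount {n : ℕ} (w : Equiv.Perm (Fin n)) : ℕ :=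
  (Finset.univ.filter fun p : Fin n × Fin n => p.1 < p.2 ∧ w p.2 < w p.1).card

/-- For `S = {s_1 < s_2 < ⋯ < s_k} ⊆ {1,…,n-1}`, `sElt n S j = s_j`, with the
conventions `s_0 = 0` and `s_j = n` for `j > k`. -/
def sElt (n : ℕ) (S : Finset ℕ) (j : ℕ) : ℕ :=
  if j = 0 then 0 else if j ≤ S.card then (S.sort (· ≤ ·)).getD (j - 1) 0 else n

lemma sElt_of_gt (n : ℕ) (S : Finset ℕ) (j : ℕ) (h : S.card < j) : sElt n S j = n := by
  unfold sElt
  rw [if_neg (by omega), if_neg (by omega)]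

/-! ### Standard Young tableaux -/

/-- A standard Young tableau of shape `μ`: a filling of the cells of `μ` by the numbers
`1,…,μ.card`, each used once, strictly increasing along rows and columns
(the entry of a non-cell is `0`). -/
structure SYT (μ : YoungDiagram) where
  entry : ℕ → ℕ → ℕ
  entry_eq_zero : ∀ i j, (i, j) ∉ μ → entry i j = 0
  row_strict : ∀ i j1 j2, j1 < j2 → (i, j2) ∈ μ → entry i j1 < entry i j2
  col_strict : ∀ i1 i2 j, i1 < i2 → (i2, j) ∈ μ → entry i1 j < entry i2 j
  bijOn : Set.BijOn (fun p : ℕ × ℕ => entry p.1 p.2) ↑μ.cells ↑(Finset.Icc 1 μ.card)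

/-- The descent set of a standard Young tableau: those `k` such that `k+1` lies in a
strictly lower row than `k`. -/
def SYT.des {μ : YoungDiagram} (Q : SYT μ) : Finset ℕ :=
  (Finset.Icc 1 (μ.card - 1)).filter fun k =>
    ∃ p1 ∈ μ.cells, ∃ p2 ∈ μ.cells,
      Q.entry p1.1 p1.2 = k ∧ Q.entry p2.1 p2.2 = k + 1 ∧ p1.1 < p2.1

/-- `fSYTRow μ t` is the number of standard Young tableaux of shape `μ` whose first row
contains the numbers `1,…,t`. -/
def fSYTRow (μ : YoungDiagram) (t : ℕ) : ℕ :=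
  Nat.card {Q : SYT μ // ∀ k, 1 ≤ k → k ≤ t → ∃ j, (0, j) ∈ μ ∧ Q.entry 0 j = k}

/-! ### Irreducible characters of the symmetric group, via Jacobi–Trudi -/

/-- The number of functions `f : Fin n → Fin k` which are invariant under `g` and whose
fiber over `i` has `c i` elements.  For `c` a composition of `n`, the function
`g ↦ fixedYoungFns n k c g` is the character of the permutation representation of `𝔖_n`
on ordered set partitions of `{1,…,n}` of type `c`, i.e. of the representation induced
from the trivial representation of the corresponding Young subgroup. -/
def fixedYoungFns (n k : ℕ) (c : Fin k → ℤ) (g : Equiv.Perm (Fin n)) : ℕ :=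
  Nat.card {f : Fin n → Fin k //
    (∀ x, f (g x) = f x) ∧ ∀ i, ((Nat.card {x : Fin n // f x = i} : ℕ) : ℤ) = c i}

/-- The irreducible character `χ^μ` of `𝔖_n` associated to a partition `μ` of `n`
(encoded as a Young diagram with `n` cells), defined through the Jacobi–Trudi
determinantal formula `χ^μ = det (h_{μ_i - i + j})`. -/
def chi (n : ℕ) (μ : YoungDiagram) (g : Equiv.Perm (Fin n)) : ℤ :=
  ∑ σ : Equiv.Perm (Fin μ.rowLens.length),
    ((Equiv.Perm.sign σ : ℤˣ) : ℤ) *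
      (fixedYoungFns n μ.rowLens.length
        (fun i => ((μ.rowLen (i : ℕ) : ℕ) : ℤ) - ((i : ℕ) : ℤ) + ((σ i : ℕ) : ℤ)) g : ℤ)

/-! ### Posets, rank selection, maximal chains and characters -/

/-- The maximal chains of the subposet induced on a subset `A` of a poset. -/
def maxChainsIn {P : Type*} [Preorder P] (A : Set P) : Set (Set P) :=
  {C | C ⊆ A ∧ IsChain (· ≤ ·) C ∧
    ∀ D : Set P, D ⊆ A → IsChain (· ≤ ·) D → C ⊆ D → C = D}

/-- The rank-selected subposet `P_S = {x ∈ P : rk x ∈ S} ∪ {⊥, ⊤}`. -/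
def rankSel {P : Type*} [Preorder P] [OrderBot P] [OrderTop P] (rk : P → ℕ)
    (S : Finset ℕ) : Set P :=
  {x | rk x ∈ S} ∪ {⊥, ⊤}

/-- `a_P(S)`: the number of maximal chains of the rank-selected subposet `P_S`. -/
def chainCount {P : Type*} [Preorder P] [OrderBot P] [OrderTop P] (rk : P → ℕ)
    (S : Finset ℕ) : ℕ :=
  Set.ncard (maxChainsIn (rankSel rk S))

/-- `b_P(S) = Σ_{T ⊆ S} (-1)^{|S-T|} a_P(T)`. -/
def bDim {P : Type*} [Preorder P] [OrderBot P] [OrderTop P] (rk : P → ℕ)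
    (S : Finset ℕ) : ℤ :=
  ∑ T ∈ S.powerset, (-1 : ℤ) ^ (S.card - T.card) * (chainCount rk T : ℤ)

/-- The character of the permutation representation `α_P(S)` of a group `G` acting (via
`act`) on the maximal chains of the rank-selected subposet `P_S`: its value at `g` is
the number of maximal chains of `P_S` fixed by `g`. -/
def gAlpha {P G : Type*} [Preorder P] [OrderBot P] [OrderTop P] (rk : P → ℕ)
    (act : G → P → P) (S : Finset ℕ) (g : G) : ℤ :=
  (Set.ncard {C : Set P | C ∈ maxChainsIn (rankSel rk S) ∧ act g '' C = C} : ℤ)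

/-- The character of the virtual representation
`β_P(S) = Σ_{T ⊆ S} (-1)^{|S-T|} α_P(T)`. -/
def gBeta {P G : Type*} [Preorder P] [OrderBot P] [OrderTop P] (rk : P → ℕ)
    (act : G → P → P) (S : Finset ℕ) (g : G) : ℤ :=
  ∑ T ∈ S.powerset, (-1 : ℤ) ^ (S.card - T.card) * gAlpha rk act T g

/-! ### The poset of injective words -/

/-- An injective word over the alphabet `{1,…,n}`. -/
def InjWord (n : ℕ) : Type := {l : List (Fin n) // l.Nodup}

instance (n : ℕ) : PartialOrder (InjWord n) where
  le u v := u.1.Sublist v.1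
  le_refl u := List.Sublist.refl _
  le_trans u v w h1 h2 := List.Sublist.trans h1 h2
  le_antisymm u v h1 h2 := Subtype.ext (List.Sublist.antisymm h1 h2)

instance (n : ℕ) : OrderBot (InjWord n) where
  bot := ⟨[], List.nodup_nil⟩
  bot_le u := List.nil_sublist u.1

/-- The rank function of the poset of injective words (with a maximum adjoined):
the rank of a word is its length, and the rank of `⊤` is `n+1`. -/
def rkInj (n : ℕ) (x : WithTop (InjWord n)) : ℕ :=
  WithTop.recTopCoe (n + 1) (fun u => u.1.length) x

/-- The action of `𝔖_n` on injective words, letter by letter. -/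
def permWord {n : ℕ} (w : Equiv.Perm (Fin n)) (u : InjWord n) : InjWord n :=
  ⟨u.1.map w, u.2.map w.injective⟩

/-- The character of `α_{P_n}(S)` for the `𝔖_n`-action on the poset of injective words. -/
def injAlpha (n : ℕ) (S : Finset ℕ) (g : Equiv.Perm (Fin n)) : ℤ :=
  gAlpha (rkInj n) (fun w : Equiv.Perm (Fin n) => WithTop.map (permWord w)) S g

/-- The character of `β_{P_n}(S)` for the `𝔖_n`-action on the poset of injective words. -/
def injBeta (n : ℕ) (S : Finset ℕ) (g : Equiv.Perm (Fin n)) : ℤ :=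
  gBeta (rkInj n) (fun w : Equiv.Perm (Fin n) => WithTop.map (permWord w)) S g

/-! ### The poset of r-colored injective words -/

/-- An `r`-colored injective word over `{1,…,n}`: a word in the alphabet
`{1,…,n} × ℤ_r` whose letters have pairwise distinct first coordinates. -/
def CInjWord (n r : ℕ) : Type := {l : List (Fin n × ZMod r) // (l.map Prod.fst).Nodup}

instance (n r : ℕ) : PartialOrder (CInjWord n r) where
  le u v := u.1.Sublist v.1
  le_refl u := List.Sublist.refl _
  le_trans u v w h1 h2 := List.Sublist.trans h1 h2
  le_antisymm u v h1 h2 := Subtype.ext (List.Sublist.antisymm h1 h2)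

instance (n r : ℕ) : OrderBot (CInjWord n r) where
  bot := ⟨[], by simp⟩
  bot_le u := List.nil_sublist u.1

/-- The rank function of the poset `P_{n,r}` of `r`-colored injective words
(with a maximum adjoined). -/
def rkC (n r : ℕ) (x : WithTop (CInjWord n r)) : ℕ :=
  WithTop.recTopCoe (n + 1) (fun u => u.1.length) x

/-- The action of `𝔖_n` on `r`-colored injective words: act on the first coordinate
of each letter, leaving colors unchanged. -/
def permCWord {n r : ℕ} (w : Equiv.Perm (Fin n)) (u : CInjWord n r) : CInjWord n r :=
  ⟨u.1.map (fun p => (w p.1, p.2)), by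
    have h := u.2.map w.injective
    rw [List.map_map] at h ⊢
    exact h⟩

/-- The character of `α_{P_{n,r}}(S)`. -/
def cAlpha (n r : ℕ) (S : Finset ℕ) (g : Equiv.Perm (Fin n)) : ℤ :=
  gAlpha (rkC n r) (fun w : Equiv.Perm (Fin n) => WithTop.map (permCWord w)) S g

/-- The character of `β_{P_{n,r}}(S)`. -/
def cBeta (n r : ℕ) (S : Finset ℕ) (g : Equiv.Perm (Fin n)) : ℤ :=
  gBeta (rkC n r) (fun w : Equiv.Perm (Fin n) => WithTop.map (permCWord w)) S g

/-- `b_{P_{n,r}}(S)`, the dimension of `β_{P_{n,r}}(S)`. -/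
def cChainDim (n r : ℕ) (S : Finset ℕ) : ℤ := bDim (rkC n r) S

/-! ### The statistics τ -/

/-- `τ(w,Q)` for a permutation `w` with descent set `S = {s_1 < ⋯ < s_k}` and a standard
Young tableau `Q`: the largest `i ∈ {0,…,k+1}` such that (a) `w(x) = w_S(x)` for
`x > s_{k+1-i}` and (b) no descent of `Q` is smaller than `n - s_{k+1-i}`. -/
def tau (n : ℕ) (S : Finset ℕ) (wS w : Equiv.Perm (Fin n)) {μ : YoungDiagram}
    (Q : SYT μ) : ℕ :=
  ((Finset.range (S.card + 2)).filter
    (fun i => (∀ x, sElt n S (S.card + 1 - i) < x → x ≤ n → permApp w x = permApp wS x) ∧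
      (∀ d ∈ Q.des, n - sElt n S (S.card + 1 - i) ≤ d))).max'
    ⟨0, by
      have hs := sElt_of_gt n S (S.card + 1 - 0) (by omega)
      refine Finset.mem_filter.2 ⟨Finset.mem_range.2 (by omega), ?_, ?_⟩
      · intro x hx hx'
        rw [hs] at hx
        exact absurd hx (not_lt.2 hx')
      · intro d _
        rw [hs]
        omega⟩

/-- The condition that all the numbers `1,…,t` appear in the first row of the `r`-colored
standard Young tableau `(Q, c)` and are colored with the zero color (the color of the
entry `k` being `c (k-1)`). -/
def zeroFirstRow {μ : YoungDiagram} {r : ℕ} (Q : SYT μ) (c : Fin μ.card → ZMod r)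
    (t : ℕ) : Prop :=
  ∀ k : Fin μ.card, (k : ℕ) < t →
    ((∃ j, (0, j) ∈ μ ∧ Q.entry 0 j = (k : ℕ) + 1) ∧ c k = 0)

/-- `τ(w,Q)` for an `r`-colored standard Young tableau `(Q,c)`. -/
def ctau (n : ℕ) {r : ℕ} (S : Finset ℕ) (wS w : Equiv.Perm (Fin n)) {μ : YoungDiagram}
    (Q : SYT μ) (c : Fin μ.card → ZMod r) : ℕ :=
  ((Finset.range (S.card + 2)).filter
    (fun i => (∀ x, sElt n S (S.card + 1 - i) < x → x ≤ n → permApp w x = permApp wS x) ∧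
      zeroFirstRow Q c (n - sElt n S (S.card + 1 - i)))).max'
    ⟨0, by
      have hs := sElt_of_gt n S (S.card + 1 - 0) (by omega)
      refine Finset.mem_filter.2 ⟨Finset.mem_range.2 (by omega), ?_, ?_⟩
      · intro x hx hx'
        rw [hs] at hx
        exact absurd hx (not_lt.2 hx')
      · rw [hs]
        intro k hk
        exact absurd hk (by omega)⟩

/-- The largest `i ∈ {0,…,n}` such that all the numbers `1,…,i` appear in the first row
of the `r`-colored standard Young tableau `(Q,c)` and are colored with the zero color. -/
def mQ (n : ℕ) {r : ℕ} {μ : YoungDiagram} (Q : SYT μ) (c : Fin μ.card → ZMod r) : ℕ :=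
  ((Finset.range (n + 1)).filter (fun i => zeroFirstRow Q c i)).max'
    ⟨0, Finset.mem_filter.2 ⟨Finset.mem_range.2 (by omega),
      fun k hk => absurd hk (by omega)⟩⟩

/-- The condition, for an `r`-colored permutation `(π, c)` (the color of the entry
`π(x)` in one-line notation being `c (x-1)`), that the entries `π(1),…,π(t)` are in
increasing order and all colored with the zero color. -/
def zeroIncreasing {n r : ℕ} (π : Equiv.Perm (Fin n)) (c : Fin n → ZMod r) (t : ℕ) : Prop :=
  (∀ x y, 1 ≤ x → x < y → y ≤ t → permApp π x < permApp π y) ∧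
  ∀ k : Fin n, (k : ℕ) < t → c k = 0

/-- `τ(w,u)` for an `r`-colored permutation `u = (π, c)`. -/
def tauU (n : ℕ) {r : ℕ} (S : Finset ℕ) (wS w : Equiv.Perm (Fin n))
    (π : Equiv.Perm (Fin n)) (c : Fin n → ZMod r) : ℕ :=
  ((Finset.range (S.card + 2)).filter
    (fun i => (∀ x, sElt n S (S.card + 1 - i) < x → x ≤ n → permApp w x = permApp wS x) ∧
      zeroIncreasing π c (n - sElt n S (S.card + 1 - i)))).max'
    ⟨0, by
      have hs := sElt_of_gt n S (S.card + 1 - 0) (by omega)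
      refine Finset.mem_filter.2 ⟨Finset.mem_range.2 (by omega), ?_, ?_, ?_⟩
      · intro x hx hx'
        rw [hs] at hx
        exact absurd hx (not_lt.2 hx')
      · intro x y hx hxy hy
        rw [hs] at hy
        exact absurd hy (by omega)
      · rw [hs]
        intro k hk
        exact absurd hk (by omega)⟩

/-- The largest `i ∈ {0,…,n}` such that the entries `π(1),…,π(i)` of the `r`-colored
permutation `(π,c)` are in increasing order and all colored with the zero color. -/
def mU (n : ℕ) {r : ℕ} (π : Equiv.Perm (Fin n)) (c : Fin n → ZMod r) : ℕ :=
  ((Finset.range (n + 1)).filter (fun i => zeroIncreasing π c i)).max'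
    ⟨0, Finset.mem_filter.2 ⟨Finset.mem_range.2 (by omega),
      fun x y hx hxy hy => absurd hy (by omega),
      fun k hk => absurd hk (by omega)⟩⟩

/-- `a_m(T)`: the number of chains in the Boolean lattice `B_m` whose elements have
set of ranks (cardinalities) equal to `T`. -/
def boolChains (m : ℕ) (T : Finset ℕ) : ℕ :=
  Nat.card {c : Finset (Finset (Fin m)) //
    IsChain (· ⊆ ·) (↑c : Set (Finset (Fin m))) ∧ c.image Finset.card = T}

end

/-- Number of chains with rank set `l` (decreasing) below an element of rank `t`. -/
def lM : List ℕ → ℕ → ℕ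
  | [], _ => 1
  | m :: l, t => t.choose m * lM l m

/-- Number of chains of subsets with set of ranks `T` below a set of size `t`. -/
def chM (T : Finset ℕ) (t : ℕ) : ℕ := lM (T.sort (· ≥ ·)) t

theorem chM_empty (t : ℕ) : chM ∅ t = 1 := by simp [chM, lM]

theorem chM_insert (T : Finset ℕ) (m t : ℕ) (h : ∀ x ∈ T, x < m) :
    chM (insert m T) t = t.choose m * chM T m := by
  have hm : m ∉ T := fun hm => lt_irrefl _ (h m hm)
  unfold chM
  rw [Finset.sort_insert (r := (· ≥ ·)) (fun b hb => (h b hb).le) hm]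
  rfl

theorem exists_arr {n : ℕ} (W : Equiv.Perm (Fin n)) (t m : ℕ) (ht : t ≤ n) (hmt : m ≤ t)
    (A : Finset (Fin n)) (hA : A ⊆ (Finset.univ.filter fun x : Fin n => (x : ℕ) < t).image W)
    (hAc : A.card = m) :
    ∃ W' : Equiv.Perm (Fin n), (∀ x : Fin n, t ≤ x → W' x = W x) ∧
      (Finset.univ.filter fun x : Fin n => (x : ℕ) < m).image W' = A ∧
      (∀ i j : Fin n, m ≤ i → i < j → (j : ℕ) < t → W' i < W' j) := by
  set V := (Finset.univ.filter fun x : Fin n => (x : ℕ) < t).image W with hV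
  have hVc : V.card = t := by
    rw [hV, Finset.card_image_of_injective _ W.injective, Fin.card_filter_val_lt]; omega
  have hBc : (V \ A).card = t - m := by
    rw [Finset.card_sdiff_of_subset hA, hVc, hAc]
  let f : Fin n → Fin n := fun x =>
    if h1 : (x : ℕ) < m then A.orderEmbOfFin hAc ⟨x, h1⟩
    else if h2 : (x : ℕ) < t then (V \ A).orderEmbOfFin hBc ⟨x - m, by omega⟩
    else W x
  have f1 : ∀ (x : Fin n) (h1 : (x : ℕ) < m), f x = A.orderEmbOfFin hAc ⟨x, h1⟩ := by
    intro x h1; simp [f, h1]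
  have f2 : ∀ (x : Fin n) (h1 : ¬ (x : ℕ) < m) (h2 : (x : ℕ) < t),
      f x = (V \ A).orderEmbOfFin hBc ⟨x - m, by omega⟩ := by
    intro x h1 h2; simp [f, h1, h2]
  have f3 : ∀ (x : Fin n) (_ : ¬ (x : ℕ) < t), f x = W x := by
    intro x h1
    have : ¬ (x : ℕ) < m := by omega
    simp [f, h1, this]
  have m1 : ∀ (x : Fin n) (h1 : (x : ℕ) < m), f x ∈ A := by
    intro x h1; rw [f1 x h1]; exact Finset.orderEmbOfFin_mem _ _ _
  have m2 : ∀ (x : Fin n) (h1 : ¬ (x : ℕ) < m) (h2 : (x : ℕ) < t), f x ∈ V \ A := by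
    intro x h1 h2; rw [f2 x h1 h2]; exact Finset.orderEmbOfFin_mem _ _ _
  have m3 : ∀ (x : Fin n) (_ : ¬ (x : ℕ) < t), f x ∉ V := by
    intro x h1; rw [f3 x h1, hV]
    simp; exact not_lt.1 h1
  have hinj : Function.Injective f := by
    intro x y hxy
    by_cases hx1 : (x : ℕ) < m <;> by_cases hy1 : (y : ℕ) < m
    · rw [f1 x hx1, f1 y hy1] at hxy
      have := (A.orderEmbOfFin hAc).injective hxy
      simp at this; exact Fin.ext this
    · by_cases hy2 : (y : ℕ) < t
      · have a := m1 x hx1; have b := m2 y hy1 hy2; rw [hxy] at a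
        simp at b; exact absurd a b.2
      · have a := m1 x hx1; have b := m3 y hy2; rw [hxy] at a
        exact absurd (hA a) b
    · by_cases hx2 : (x : ℕ) < t
      · have a := m1 y hy1; have b := m2 x hx1 hx2; rw [← hxy] at a
        simp at b; exact absurd a b.2
      · have a := m1 y hy1; have b := m3 x hx2; rw [← hxy] at a
        exact absurd (hA a) b
    · by_cases hx2 : (x : ℕ) < t <;> by_cases hy2 : (y : ℕ) < t
      · rw [f2 x hx1 hx2, f2 y hy1 hy2] at hxy
        have := ((V \ A).orderEmbOfFin hBc).injective hxy
        simp at this; apply Fin.ext; omega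
      · have a := m2 x hx1 hx2; have b := m3 y hy2; rw [hxy] at a
        exact absurd (Finset.mem_sdiff.1 a).1 b
      · have a := m2 y hy1 hy2; have b := m3 x hx2; rw [← hxy] at a
        exact absurd (Finset.mem_sdiff.1 a).1 b
      · rw [f3 x hx2, f3 y hy2] at hxy
        exact W.injective hxy
  refine ⟨Equiv.ofBijective f (Finite.injective_iff_bijective.1 hinj), ?_, ?_, ?_⟩
  · intro x hx; exact f3 x (by omega)
  · apply Finset.eq_of_subset_of_card_le
    · intro y hy
      obtain ⟨x, hx, rfl⟩ := Finset.mem_image.1 hy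
      exact m1 x (Finset.mem_filter.1 hx).2
    · rw [Finset.card_image_of_injective _ (Equiv.injective _), Fin.card_filter_val_lt, hAc]; omega
  · intro i j hi hij hj
    have hij' : (i : ℕ) < j := hij
    change f i < f j
    rw [f2 i (by omega) (by omega), f2 j (by omega) (by omega)]
    simp; omega

theorem arr_unique {n : ℕ} (w w' : Equiv.Perm (Fin n)) (t m : ℕ)
    (h : ∀ x : Fin n, t ≤ x → w x = w' x)
    (hi : (Finset.univ.filter fun x : Fin n => (x : ℕ) < m).image w =
      (Finset.univ.filter fun x : Fin n => (x : ℕ) < m).image w')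
    (h1 : ∀ i j : Fin n, m ≤ i → i < j → (j : ℕ) < t → w i < w j)
    (h2 : ∀ i j : Fin n, m ≤ i → i < j → (j : ℕ) < t → w' i < w' j) :
    ∀ x : Fin n, m ≤ x → w x = w' x := by
  have key : ∀ (w w' : Equiv.Perm (Fin n)), (∀ x : Fin n, t ≤ x → w x = w' x) →
      ((Finset.univ.filter fun x : Fin n => (x : ℕ) < m).image w =
      (Finset.univ.filter fun x : Fin n => (x : ℕ) < m).image w') →
      ∀ x : Fin n, m ≤ x → (x : ℕ) < t → ∃ y : Fin n, (m ≤ y ∧ (y : ℕ) < t) ∧ w' y = w x := by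
    intro w w' h hi x hx1 hx2
    refine ⟨w'.symm (w x), ⟨?_, ?_⟩, by simp⟩
    · by_contra hc
      have : w x ∈ (Finset.univ.filter fun x : Fin n => (x : ℕ) < m).image w' :=
        Finset.mem_image.2 ⟨w'.symm (w x), by simpa using hc, by simp⟩
      rw [← hi] at this
      obtain ⟨z, hz, hz'⟩ := Finset.mem_image.1 this
      have := w.injective hz'
      subst this
      simp at hz; omega
    · by_contra hc
      have := h _ (not_lt.1 hc)
      simp at this
      rw [this] at hc
      omega
  intro x hx
  by_cases hxt : t ≤ (x : ℕ)
  · exact h x hxt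
  let β := {x : Fin n // m ≤ (x : ℕ) ∧ (x : ℕ) < t}
  let f : β → Fin n := fun x => w x.1
  let g : β → Fin n := fun x => w' x.1
  have hf : StrictMono f := fun a b hab => h1 a.1 b.1 a.2.1 hab b.2.2
  have hg : StrictMono g := fun a b hab => h2 a.1 b.1 a.2.1 hab b.2.2
  have hr : Set.range f = Set.range g := by
    ext y
    constructor
    · rintro ⟨x, rfl⟩
      obtain ⟨y, hy, hy'⟩ := key w w' h hi x.1 x.2.1 x.2.2
      exact ⟨⟨y, hy⟩, hy'⟩
    · rintro ⟨x, rfl⟩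
      obtain ⟨y, hy, hy'⟩ := key w' w (fun x hx => (h x hx).symm) hi.symm x.1 x.2.1 x.2.2
      exact ⟨⟨y, hy⟩, hy'⟩
  have := (StrictMono.range_inj hf hg).1 hr
  exact congrFun this ⟨x, hx, not_le.1 hxt⟩

theorem mono_of_adj {n : ℕ} (w : Fin n → Fin n) (m t : ℕ)
    (h : ∀ i j : Fin n, (i : ℕ) + 1 = j → m ≤ i → (j : ℕ) < t → w i < w j) :
    ∀ i j : Fin n, m ≤ i → i < j → (j : ℕ) < t → w i < w j := by
  have key : ∀ d : ℕ, ∀ i j : Fin n, (i : ℕ) + d + 1 = j → m ≤ i → (j : ℕ) < t → w i < w j := by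
    intro d
    induction d with
    | zero => intro i j hij; exact h i j (by omega)
    | succ d ih =>
      intro i j hij hm ht
      have hk : (i : ℕ) + d + 1 < n := by omega
      exact lt_trans (ih i ⟨i + d + 1, hk⟩ rfl hm (by simp; omega))
        (h ⟨i + d + 1, hk⟩ j (by simp; omega) (by simp; omega) ht)
  intro i j hm hij ht
  have : (i : ℕ) < j := hij
  exact key (j - i - 1) i j (by omega) hm ht

/-- permutations agreeing with `W` beyond `t`, with descents before `t` inside `T` -/
def pset {n : ℕ} (W : Equiv.Perm (Fin n)) (T : Finset ℕ) (t : ℕ) : Finset (Equiv.Perm (Fin n)) :=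
  Finset.univ.filter fun w => (∀ x : Fin n, t ≤ x → w x = W x) ∧
    ∀ i j : Fin n, (i : ℕ) + 1 = j → (j : ℕ) < t → (j : ℕ) ∉ T → w i < w j

theorem card_pset {n : ℕ} (T : Finset ℕ) : ∀ (W : Equiv.Perm (Fin n)) (t : ℕ), t ≤ n →
    (∀ x ∈ T, x < t) → (pset W T t).card = chM T t := by
  induction T using Finset.induction_on_max with
  | empty =>
    intro W t ht _
    rw [chM_empty, Finset.card_eq_one]
    obtain ⟨W', h1, h2, h3⟩ := exists_arr W t 0 ht (Nat.zero_le _) ∅ (by simp) (by simp)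
    refine ⟨W', ?_⟩
    ext w
    simp only [pset, Finset.mem_filter, Finset.mem_univ, true_and, Finset.mem_singleton]
    constructor
    · rintro ⟨ha, hb⟩
      ext x : 1
      refine arr_unique w W' t 0 (fun x hx => by rw [ha x hx, h1 x hx]) (by simp) ?_ h3 x
        (Nat.zero_le _)
      exact mono_of_adj w 0 t (fun i j hij _ hj => hb i j hij hj (by simp))
    · rintro rfl
      exact ⟨h1, fun i j hij hj _ => h3 i j (Nat.zero_le _) (Fin.lt_def.2 (by omega)) hj⟩
  | insert m T hm ih =>
    intro W t ht hT
    have hmt : m < t := hT m (Finset.mem_insert_self _ _)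
    rw [chM_insert T m t hm]
    set V := (Finset.univ.filter fun x : Fin n => (x : ℕ) < t).image W with hV
    have hVc : V.card = t := by
      rw [hV, Finset.card_image_of_injective _ W.injective, Fin.card_filter_val_lt]; omega
    have hmaps : ∀ w ∈ pset W (insert m T) t,
        (Finset.univ.filter fun x : Fin n => (x : ℕ) < m).image w ∈ V.powersetCard m := by
      intro w hw
      simp only [pset, Finset.mem_filter, Finset.mem_univ, true_and] at hw
      rw [Finset.mem_powersetCard]
      constructor
      · intro y hy
        obtain ⟨x, hx, rfl⟩ := Finset.mem_image.1 hy
        simp at hx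
        refine Finset.mem_image.2 ⟨W.symm (w x), ?_, by simp⟩
        simp
        by_contra hc
        have := hw.1 _ (not_lt.1 hc)
        simp at this
        rw [this] at hc; omega
      · rw [Finset.card_image_of_injective _ (Equiv.injective _), Fin.card_filter_val_lt]; omega
    rw [Finset.card_eq_sum_card_fiberwise hmaps]
    have : ∀ A ∈ V.powersetCard m, ((pset W (insert m T) t).filter fun w : Equiv.Perm (Fin n) =>
        (Finset.univ.filter fun x : Fin n => (x : ℕ) < m).image w = A).card = chM T m := by
      intro A hA
      rw [Finset.mem_powersetCard] at hA
      obtain ⟨W', h1, h2, h3⟩ := exists_arr W t m ht hmt.le A hA.1 hA.2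
      rw [← ih W' m (by omega) hm]
      congr 1
      ext w
      simp only [pset, Finset.mem_filter, Finset.mem_univ, true_and]
      constructor
      · rintro ⟨⟨ha, hb⟩, hc⟩
        refine ⟨?_, ?_⟩
        · apply arr_unique w W' t m (fun x hx => by rw [ha x hx, h1 x hx]) (by rw [hc, h2]) _ h3
          refine mono_of_adj w m t (fun i j hij hi hj => hb i j hij hj ?_)
          rw [Finset.mem_insert]
          rintro (h | h)
          · omega
          · have := hm _ h; omega
        · intro i j hij hj hjT
          refine hb i j hij (by omega) ?_
          rw [Finset.mem_insert]
          rintro (h | h)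
          · omega
          · exact hjT h
      · rintro ⟨ha, hb⟩
        refine ⟨⟨fun x hx => by rw [ha x (by omega), h1 x hx], ?_⟩, ?_⟩
        · intro i j hij hj hjT
          rw [Finset.mem_insert, not_or] at hjT
          by_cases hjm : (j : ℕ) < m
          · exact hb i j hij hjm hjT.2
          · rw [ha i (by omega), ha j (by omega)]
            exact h3 i j (by omega) (Fin.lt_def.2 (by omega)) hj
        · rw [← h2]
          apply Finset.eq_of_subset_of_card_le
          · intro y hy
            obtain ⟨x, hx, rfl⟩ := Finset.mem_image.1 hy
            refine Finset.mem_image.2 ⟨W'.symm (w x), ?_, by simp⟩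
            simp at hx ⊢
            by_contra hc
            have := ha _ (not_lt.1 hc)
            simp at this
            rw [this] at hc; omega
          · rw [Finset.card_image_of_injective _ (Equiv.injective _),
              Finset.card_image_of_injective _ (Equiv.injective _)]
    rw [Finset.sum_congr rfl this]
    simp [hVc]


theorem permApp_succ {n : ℕ} (w : Equiv.Perm (Fin n)) (x : Fin n) :
    permApp w (x + 1) = (w x : ℕ) + 1 := by
  unfold permApp
  rw [dif_pos (by simp)]
  simp

theorem mem_descentSet {n : ℕ} (w : Equiv.Perm (Fin n)) (s : ℕ) :
    s ∈ descentSet w ↔ ∃ i j : Fin n, (i : ℕ) + 1 = j ∧ (j : ℕ) = s ∧ w j < w i := by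
  unfold descentSet
  rw [Finset.mem_filter, Finset.mem_Icc]
  constructor
  · rintro ⟨⟨h1, h2⟩, h3⟩
    refine ⟨⟨s - 1, by omega⟩, ⟨s, by omega⟩, by simp; omega, rfl, ?_⟩
    have e1 := permApp_succ w ⟨s, by omega⟩
    have e2 := permApp_succ w ⟨s - 1, by omega⟩
    simp only at e1 e2
    rw [show s - 1 + 1 = s by omega] at e2
    rw [e1, e2] at h3
    exact Fin.lt_def.2 (by omega)
  · rintro ⟨i, j, hij, rfl, h⟩
    refine ⟨⟨by omega, by omega⟩, ?_⟩
    rw [permApp_succ w j, ← hij, permApp_succ w i]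
    have := Fin.lt_def.1 h
    omega

/-- key for the standard longest permutation -/
def keyF {n : ℕ} (S : Finset ℕ) (x : Fin n) : ℕ := n * (S.filter fun s => (x : ℕ) < s).card + x

theorem exists_long {n : ℕ} (S : Finset ℕ) :
    ∃ v : Equiv.Perm (Fin n), ∀ x y, v x < v y ↔ keyF S x < keyF S y := by
  have hinj : Function.Injective (keyF (n := n) S) := by
    intro x y h
    unfold keyF at h
    have h1 : (x : ℕ) % n = y % n := by
      have := congrArg (· % n) h
      simpa [Nat.add_mod] using this
    rw [Nat.mod_eq_of_lt x.2, Nat.mod_eq_of_lt y.2] at h1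
    exact Fin.ext h1
  have hm : StrictMono (keyF S ∘ Tuple.sort (keyF (n := n) S)) :=
    (Tuple.monotone_sort _).strictMono_of_injective (hinj.comp (Equiv.injective _))
  refine ⟨(Tuple.sort (keyF S))⁻¹, fun x y => ?_⟩
  have := hm.lt_iff_lt (a := (Tuple.sort (keyF S))⁻¹ x) (b := (Tuple.sort (keyF S))⁻¹ y)
  rw [← this]
  simp

theorem keyF_lt_of_sep {n : ℕ} (S : Finset ℕ) (x y : Fin n) (s : ℕ) (hs : s ∈ S)
    (h1 : (x : ℕ) < s) (h2 : s ≤ y) : keyF S y < keyF S x := by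
  unfold keyF
  have : (S.filter fun s => (y : ℕ) < s).card < (S.filter fun s => (x : ℕ) < s).card := by
    apply Finset.card_lt_card
    rw [Finset.ssubset_iff_of_subset]
    · exact ⟨s, by simp [hs, h1], by simp [hs, h2]⟩
    · intro z hz
      simp at hz ⊢
      exact ⟨hz.1, by omega⟩
  have h3 : n * ((S.filter fun s => (y : ℕ) < s).card + 1) ≤
    n * (S.filter fun s => (x : ℕ) < s).card := Nat.mul_le_mul_left _ this
  have := y.2
  rw [Nat.mul_add] at h3
  omega

theorem keyF_lt_of_not_sep {n : ℕ} (S : Finset ℕ) (x y : Fin n) (hxy : x < y)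
    (h : ∀ s ∈ S, ¬ ((x : ℕ) < s ∧ s ≤ y)) : keyF S x < keyF S y := by
  unfold keyF
  have : (S.filter fun s => (y : ℕ) < s) = (S.filter fun s => (x : ℕ) < s) := by
    ext z
    simp only [Finset.mem_filter]
    have := Fin.lt_def.1 hxy
    constructor
    · rintro ⟨h1, h2⟩; exact ⟨h1, by omega⟩
    · rintro ⟨h1, h2⟩
      have := h z h1
      exact ⟨h1, by omega⟩
  rw [this]
  have := Fin.lt_def.1 hxy
  omega

theorem wS_sep {n : ℕ} (S : Finset ℕ) (hS : S ⊆ Finset.Icc 1 (n - 1))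
    (wS : Equiv.Perm (Fin n)) (hwS : descentSet wS = S)
    (hmax : ∀ v : Equiv.Perm (Fin n), descentSet v = S → invCount v ≤ invCount wS)
    (x y : Fin n) (s : ℕ) (hs : s ∈ S) (h1 : (x : ℕ) < s) (h2 : s ≤ y) : wS y < wS x := by
  obtain ⟨v, hv⟩ := exists_long (n := n) S
  have hd : descentSet v = S := by
    ext s
    rw [mem_descentSet]
    constructor
    · rintro ⟨i, j, hij, rfl, h⟩
      by_contra hc
      rw [hv] at h
      have := keyF_lt_of_not_sep S i j (Fin.lt_def.2 (by omega)) (fun s hs hh => by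
        have : s = j := by omega
        subst this; exact hc hs)
      omega
    · intro hs
      have := Finset.mem_Icc.1 (hS hs)
      refine ⟨⟨s - 1, by omega⟩, ⟨s, by omega⟩, by simp; omega, rfl, ?_⟩
      rw [hv]
      exact keyF_lt_of_sep S _ _ s hs (by simp; omega) (by simp)
  have hle := hmax v hd
  unfold invCount at hle
  have hsub : (Finset.univ.filter fun p : Fin n × Fin n => p.1 < p.2 ∧ wS p.2 < wS p.1) ⊆
      (Finset.univ.filter fun p : Fin n × Fin n => p.1 < p.2 ∧ v p.2 < v p.1) := by
    rintro ⟨a, b⟩ hab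
    simp only [Finset.mem_filter, Finset.mem_univ, true_and] at hab ⊢
    refine ⟨hab.1, ?_⟩
    by_contra hc
    have hc' : ∀ s ∈ S, ¬ ((a : ℕ) < s ∧ s ≤ b) := by
      intro s hs hh
      exact hc ((hv _ _).2 (keyF_lt_of_sep S a b s hs hh.1 hh.2))
    have hmono := mono_of_adj wS a (b + 1) (by
      intro i j hij hai hjb
      rcases lt_trichotomy (wS i) (wS j) with h | h | h
      · exact h
      · have := wS.injective h; subst this; omega
      · have : (j : ℕ) ∈ descentSet wS := (mem_descentSet _ _).2 ⟨i, j, hij, rfl, h⟩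
        rw [hwS] at this
        exact absurd ⟨by omega, by omega⟩ (hc' _ this))
    have := hmono a b le_rfl hab.1 (by omega)
    exact absurd hab.2 (not_lt.2 this.le)
  have heq := Finset.eq_of_subset_of_card_le hsub hle
  have : (x, y) ∈ (Finset.univ.filter fun p : Fin n × Fin n => p.1 < p.2 ∧ v p.2 < v p.1) := by
    simp only [Finset.mem_filter, Finset.mem_univ, true_and]
    exact ⟨Fin.lt_def.2 (by omega), (hv _ _).2 (keyF_lt_of_sep S x y s hs h1 h2)⟩
  rw [← heq] at this
  simp only [Finset.mem_filter, Finset.mem_univ, true_and] at this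
  exact this.2

/-- permutations of descent set `S` agreeing with `wS` beyond `t` -/
def dset {n : ℕ} (S : Finset ℕ) (wS : Equiv.Perm (Fin n)) (t : ℕ) : Finset (Equiv.Perm (Fin n)) :=
  Finset.univ.filter fun w => descentSet w = S ∧ ∀ x : Fin n, t ≤ x → w x = wS x

theorem sum_neg_one_pow_between (D U : Finset ℕ) (hD : D ⊆ U) :
    (∑ T ∈ U.powerset, if D ⊆ T then (-1 : ℤ) ^ (U.card - T.card) else 0) =
      if D = U then 1 else 0 := by
  have h1 : (∑ T ∈ U.powerset, if D ⊆ T then (-1 : ℤ) ^ (U.card - T.card) else 0) =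
      ∑ R ∈ (U \ D).powerset, (-1 : ℤ) ^ R.card := by
    rw [← Finset.sum_filter]
    refine Finset.sum_bij' (fun T _ => U \ T) (fun R _ => U \ R) ?_ ?_ ?_ ?_ ?_
    · intro T hT
      exact Finset.mem_powerset.2 (Finset.sdiff_subset_sdiff le_rfl (Finset.mem_filter.1 hT).2)
    · intro R hR; simp at hR ⊢
      intro x hx
      simp [hD hx]
      intro hxR
      have := hR hxR
      simp at this
      exact this.2 hx
    · intro T hT; simp at hT
      simp [hT.1]
    · intro R hR; simp at hR
      have : R ⊆ U := hR.trans Finset.sdiff_subset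
      simp [this]
    · intro T hT; simp at hT
      rw [Finset.card_sdiff_of_subset hT.1]
  rw [h1, Finset.sum_powerset_neg_one_pow_card]
  congr 1
  rw [Finset.sdiff_eq_empty_iff_subset]
  exact propext ⟨fun h => hD.antisymm h, fun h => h ▸ le_rfl⟩

theorem card_dset {n : ℕ} (S : Finset ℕ) (hS : S ⊆ Finset.Icc 1 (n - 1))
    (wS : Equiv.Perm (Fin n)) (hwS : descentSet wS = S)
    (hmax : ∀ v : Equiv.Perm (Fin n), descentSet v = S → invCount v ≤ invCount wS)
    (s : ℕ) (hs : s ∈ S) :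
    ((dset S wS s).card : ℤ) = ∑ T ∈ (S.filter (· < s)).powerset,
      (-1 : ℤ) ^ ((S.filter (· < s)).card - T.card) * (chM T s : ℤ) := by
  have hsn := Finset.mem_Icc.1 (hS hs)
  set U := S.filter (· < s) with hU
  have e1 : ∀ T ∈ U.powerset, (-1 : ℤ) ^ (U.card - T.card) * (chM T s : ℤ) =
      ∑ w : Equiv.Perm (Fin n), if (∀ x : Fin n, s ≤ x → w x = wS x) ∧
        (descentSet w).filter (· < s) ⊆ T then (-1 : ℤ) ^ (U.card - T.card) else 0 := by
    intro T hT
    have hT' : ∀ x ∈ T, x < s := fun x hx =>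
      (Finset.mem_filter.1 (Finset.mem_powerset.1 hT hx)).2
    rw [← card_pset T wS s (by omega) hT', ← Finset.sum_filter, Finset.sum_const, nsmul_eq_mul,
      mul_comm]
    congr 3
    ext w
    simp only [pset, Finset.mem_filter, Finset.mem_univ, true_and]
    refine and_congr_right fun _ => ?_
    constructor
    · intro h d hd
      rw [Finset.mem_filter, mem_descentSet] at hd
      obtain ⟨⟨i, j, hij, rfl, h3⟩, h4⟩ := hd
      by_contra hc
      exact absurd h3 (not_lt.2 (h i j hij h4 hc).le)
    · intro h i j hij hj hjT
      rcases lt_trichotomy (w i) (w j) with h' | h' | h'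
      · exact h'
      · have := w.injective h'; subst this; omega
      · exact absurd (h (Finset.mem_filter.2 ⟨(mem_descentSet _ _).2 ⟨i, j, hij, rfl, h'⟩, hj⟩)) hjT
  rw [Finset.sum_congr rfl e1, Finset.sum_comm]
  unfold dset
  rw [Finset.card_filter]
  push_cast
  refine Finset.sum_congr rfl fun w _ => ?_
  by_cases hw : ∀ x : Fin n, s ≤ x → w x = wS x
  swap
  · rw [if_neg (by tauto)]
    symm
    exact Finset.sum_eq_zero fun T _ => if_neg (by tauto)
  have hlow : ∀ x y : Fin n, (x : ℕ) < s → s ≤ y → w y < w x := by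
    intro x y hx hy
    rw [hw y hy]
    have : (wS.symm (w x) : ℕ) < s := by
      by_contra hc
      have := hw _ (not_lt.1 hc)
      simp at this
      rw [this] at hc
      omega
    have := wS_sep S hS wS hwS hmax _ y s hs this hy
    simpa using this
  have hdes : ∀ d, s ≤ d → (d ∈ descentSet w ↔ d ∈ S) := by
    intro d hd
    rcases hd.eq_or_lt with rfl | hd
    · refine iff_of_true ?_ hs
      rw [mem_descentSet]
      exact ⟨⟨s - 1, by omega⟩, ⟨s, by omega⟩, by simp; omega, rfl,
        hlow _ _ (by simp; omega) (by simp)⟩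
    · rw [← hwS, mem_descentSet, mem_descentSet]
      constructor
      · rintro ⟨i, j, hij, rfl, h⟩
        exact ⟨i, j, hij, rfl, by rwa [← hw i (by omega), ← hw j (by omega)]⟩
      · rintro ⟨i, j, hij, rfl, h⟩
        exact ⟨i, j, hij, rfl, by rwa [hw i (by omega), hw j (by omega)]⟩
  have hiff : descentSet w = S ↔ (descentSet w).filter (· < s) = U := by
    constructor
    · intro h; rw [h]
    · intro h
      ext d
      by_cases hd : s ≤ d
      · exact hdes d hd
      · have := congrArg (d ∈ ·) h
        simpa [hU, not_le.1 hd] using this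
  have hwt := eq_true hw
  simp only [hwt, and_true, true_and]
  rw [if_congr hiff rfl rfl]
  by_cases hD : (descentSet w).filter (· < s) ⊆ U
  · rw [sum_neg_one_pow_between _ _ hD]
  · rw [if_neg (fun h => hD h.le), eq_comm]
    refine Finset.sum_eq_zero fun T hT => if_neg fun h => hD (h.trans (Finset.mem_powerset.1 hT))

theorem card_dset_zero {n : ℕ} (S : Finset ℕ) (wS : Equiv.Perm (Fin n))
    (hwS : descentSet wS = S) : (dset S wS 0).card = 1 := by
  rw [Finset.card_eq_one]
  refine ⟨wS, ?_⟩
  ext w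
  simp only [dset, Finset.mem_filter, Finset.mem_univ, true_and, Finset.mem_singleton,
    Nat.zero_le, forall_const]
  constructor
  · rintro ⟨_, h⟩; ext x : 1; exact h x
  · rintro rfl; exact ⟨hwS, fun _ => rfl⟩


theorem sElt_pos (n : ℕ) (S : Finset ℕ) (j : ℕ) (h : j < S.card) :
    sElt n S (j + 1) = S.orderEmbOfFin rfl ⟨j, h⟩ := by
  unfold sElt
  rw [if_neg (by omega), if_pos (by omega)]
  simp only [Nat.add_sub_cancel]
  rw [List.getD_eq_getElem _ _ (by simpa using h)]
  rfl

theorem sElt_zero (n : ℕ) (S : Finset ℕ) : sElt n S 0 = 0 := by simp [sElt]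

theorem sElt_mem (n : ℕ) (S : Finset ℕ) (j : ℕ) (h : j ≤ S.card) : sElt n S j ∈ insert 0 S := by
  cases j with
  | zero => simp [sElt_zero]
  | succ j =>
    rw [sElt_pos n S j (by omega)]
    exact Finset.mem_insert_of_mem (Finset.orderEmbOfFin_mem _ _ _)

theorem card_gt_sElt (n : ℕ) (S : Finset ℕ) (hS : S ⊆ Finset.Icc 1 (n - 1)) (j : ℕ)
    (h : j ≤ S.card) : (S.filter (sElt n S j < ·)).card = S.card - j := by
  cases j with
  | zero =>
    rw [sElt_zero, Finset.filter_true_of_mem]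
    · simp
    · intro x hx; have := Finset.mem_Icc.1 (hS hx); omega
  | succ j =>
    rw [sElt_pos n S j (by omega)]
    have : S.filter (S.orderEmbOfFin rfl ⟨j, by omega⟩ < ·) =
        (Finset.univ.filter fun i : Fin S.card => j < i).image (S.orderEmbOfFin rfl) := by
      ext x
      simp only [Finset.mem_filter, Finset.mem_image, Finset.mem_univ, true_and]
      constructor
      · rintro ⟨hx, hlt⟩
        have : x ∈ Set.range (S.orderEmbOfFin rfl) := by
          rw [Finset.range_orderEmbOfFin]; exact hx
        obtain ⟨i, rfl⟩ := this
        exact ⟨i, by simpa [Fin.lt_def] using hlt, rfl⟩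
      · rintro ⟨i, hi, rfl⟩
        exact ⟨Finset.orderEmbOfFin_mem _ _ _, by simpa [Fin.lt_def] using hi⟩
    rw [this, Finset.card_image_of_injective _ (S.orderEmbOfFin rfl).injective]
    have h2 : (Finset.univ.filter fun i : Fin S.card => j < i) = Finset.Ioi ⟨j, by omega⟩ := by
      ext i; simp [Fin.lt_def]
    rw [h2, Fin.card_Ioi]
    simp; omega

theorem sElt_card_gt (n : ℕ) (S : Finset ℕ) (hS : S ⊆ Finset.Icc 1 (n - 1)) (s : ℕ)
    (hs : s ∈ insert 0 S) : sElt n S (S.card - (S.filter (s < ·)).card) = s := by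
  rcases Finset.mem_insert.1 hs with rfl | hs
  · rw [Finset.filter_true_of_mem]
    · simp [sElt_zero]
    · intro x hx; have := Finset.mem_Icc.1 (hS hx); omega
  · have : s ∈ Set.range (S.orderEmbOfFin rfl) := by
      rw [Finset.range_orderEmbOfFin]; exact hs
    obtain ⟨i, rfl⟩ := this
    rw [← sElt_pos n S i i.2, card_gt_sElt n S hS _ (by omega)]
    congr 1; omega

theorem sElt_mono (n : ℕ) (S : Finset ℕ) (hS : S ⊆ Finset.Icc 1 (n - 1)) (i j : ℕ)
    (hij : i ≤ j) : sElt n S i ≤ sElt n S j := by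
  by_cases hj : S.card < j
  · rw [sElt_of_gt n S j hj]
    by_cases hi : S.card < i
    · rw [sElt_of_gt n S i hi]
    · rcases Finset.mem_insert.1 (sElt_mem n S i (by omega)) with h | h
      · omega
      · have := Finset.mem_Icc.1 (hS h); omega
  · cases i with
    | zero => simp [sElt_zero]
    | succ i =>
      cases j with
      | zero => omega
      | succ j =>
        rw [sElt_pos n S i (by omega), sElt_pos n S j (by omega)]
        simp; omega

theorem odd_max (K : ℕ) (P : ℕ → Prop) [DecidablePred P] (hP : ∀ i j, i ≤ j → P j → P i)
    (hne : ((Finset.range (K + 1)).filter P).Nonempty) :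
    (if Odd (((Finset.range (K + 1)).filter P).max' hne) then (1 : ℤ) else 0) =
      ∑ i ∈ Finset.range K, if P (i + 1) then (-1 : ℤ) ^ i else 0 := by
  set M := ((Finset.range (K + 1)).filter P).max' hne with hM
  have hmem := Finset.max'_mem _ hne
  rw [← hM, Finset.mem_filter, Finset.mem_range] at hmem
  have h1 : ∀ i, i < K → (P (i + 1) ↔ i < M) := by
    intro i hi
    constructor
    · intro h
      exact Finset.le_max' _ (i + 1) (Finset.mem_filter.2 ⟨Finset.mem_range.2 (by omega), h⟩)
    · intro h
      exact hP (i + 1) M h hmem.2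
  have h2 : (∑ i ∈ Finset.range K, if P (i + 1) then (-1 : ℤ) ^ i else 0) =
      ∑ i ∈ Finset.range M, (-1 : ℤ) ^ i := by
    rw [← Finset.sum_filter]
    congr 1
    ext i
    simp only [Finset.mem_filter, Finset.mem_range]
    constructor
    · rintro ⟨ha, hb⟩; exact (h1 i ha).1 hb
    · intro h; exact ⟨by omega, (h1 i (by omega)).2 h⟩
  rw [h2, neg_one_geom_sum]
  by_cases h : Odd M
  · rw [if_pos h, if_neg (by rwa [Nat.not_even_iff_odd])]
  · rw [if_neg h, if_pos (by rwa [← Nat.not_odd_iff_even])]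

theorem permApp_beyond {n : ℕ} (w wS : Equiv.Perm (Fin n)) (t : ℕ) :
    (∀ x, t < x → x ≤ n → permApp w x = permApp wS x) ↔ ∀ x : Fin n, t ≤ x → w x = wS x := by
  constructor
  · intro h x hx
    have := h (x + 1) (by omega) (by omega)
    rw [permApp_succ, permApp_succ] at this
    exact Fin.ext (by omega)
  · intro h x hx hxn
    have := h ⟨x - 1, by omega⟩ (by simp; omega)
    have e1 := permApp_succ w ⟨x - 1, by omega⟩
    have e2 := permApp_succ wS ⟨x - 1, by omega⟩
    simp only [show x - 1 + 1 = x by omega] at e1 e2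
    rw [e1, e2, this]

theorem ctau_odd {n r : ℕ} (S : Finset ℕ) (hS : S ⊆ Finset.Icc 1 (n - 1))
    (wS w : Equiv.Perm (Fin n)) {μ : YoungDiagram} (Q : SYT μ) (c : Fin μ.card → ZMod r) :
    (if Odd (ctau n S wS w Q c) then (1 : ℤ) else 0) =
      ∑ s ∈ insert 0 S, (-1 : ℤ) ^ (S.filter (s < ·)).card *
        if (∀ x : Fin n, s ≤ x → w x = wS x) ∧ zeroFirstRow Q c (n - s) then 1 else 0 := by
  unfold ctau
  refine (odd_max (S.card + 1) (fun i => (∀ x, sElt n S (S.card + 1 - i) < x → x ≤ n →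
    permApp w x = permApp wS x) ∧ zeroFirstRow Q c (n - sElt n S (S.card + 1 - i))) ?_ _).trans ?_
  rotate_left
  · have e : (∑ s ∈ insert 0 S, (-1 : ℤ) ^ (S.filter (s < ·)).card *
        if (∀ x : Fin n, s ≤ x → w x = wS x) ∧ zeroFirstRow Q c (n - s) then 1 else 0) =
      ∑ i ∈ Finset.range (S.card + 1), (-1 : ℤ) ^ i *
        if (∀ x : Fin n, sElt n S (S.card - i) ≤ x → w x = wS x) ∧
          zeroFirstRow Q c (n - sElt n S (S.card - i)) then 1 else 0 := by
      refine Finset.sum_bij' (fun s _ => (S.filter (s < ·)).card)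
        (fun i _ => sElt n S (S.card - i)) ?_ ?_ ?_ ?_ ?_
      · intro s _
        have := Finset.card_filter_le S (s < ·)
        simp only [Finset.mem_range]; omega
      · intro i hi
        exact sElt_mem n S _ (by omega)
      · intro s hs; exact sElt_card_gt n S hS s hs
      · intro i hi
        simp only [Finset.mem_range] at hi
        rw [card_gt_sElt n S hS _ (by omega)]; omega
      · intro s hs
        rw [sElt_card_gt n S hS s hs]
    rw [e]
    refine Finset.sum_congr rfl fun i _ => ?_
    rw [show S.card + 1 - (i + 1) = S.card - i by omega, permApp_beyond]
    split_ifs <;> simp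
  · intro i j hij
    rintro ⟨h1, h2⟩
    have := sElt_mono n S hS (S.card + 1 - j) (S.card + 1 - i) (by omega)
    exact ⟨fun x hx => h1 x (by omega), fun k hk => h2 k (by omega)⟩


section chains
variable {P : Type} [PartialOrder P]

/-- chains with rank set `U`, elements satisfying `p` and below `v` -/
def ChF (rk : P → ℕ) (p : P → Prop) (U : Finset ℕ) (v : P) : Set (Set P) :=
  {C | IsChain (· ≤ ·) C ∧ rk '' C = ↑U ∧ ∀ x ∈ C, p x ∧ x ≤ v}

theorem chain_rk_inj {rk : P → ℕ} (hrk : StrictMono rk) {C : Set P} (hC : IsChain (· ≤ ·) C)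
    {x y : P} (hx : x ∈ C) (hy : y ∈ C) (h : rk x = rk y) : x = y := by
  rcases hC.total hx hy with h' | h'
  · rcases h'.eq_or_lt with h' | h'
    · exact h'
    · exact absurd (hrk h') (by omega)
  · rcases h'.eq_or_lt with h' | h'
    · exact h'.symm
    · exact absurd (hrk h') (by omega)

theorem chain_le_of_rk {rk : P → ℕ} (hrk : StrictMono rk) {C : Set P} (hC : IsChain (· ≤ ·) C)
    {x y : P} (hx : x ∈ C) (hy : y ∈ C) (h : rk x ≤ rk y) : x ≤ y := by
  rcases hC.total hx hy with h' | h'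
  · exact h'
  · rcases h'.eq_or_lt with h' | h'
    · exact h'.ge
    · exact absurd (hrk h') (by omega)

theorem card_ChF_empty (rk : P → ℕ) (p : P → Prop) (v : P) :
    Nat.card (ChF rk p ∅ v) = 1 := by
  have : ChF rk p ∅ v = {∅} := by
    ext C
    simp only [ChF, Set.mem_ofPred_eq, Finset.coe_empty, Set.image_eq_empty, Set.mem_singleton_iff]
    constructor
    · rintro ⟨_, h, _⟩; exact h
    · rintro rfl
      exact ⟨by simp [IsChain], rfl, by simp⟩
  rw [this]
  simp

theorem card_ChF_insert [Finite P] (rk : P → ℕ) (hrk : StrictMono rk) (p : P → Prop)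
    (U : Finset ℕ) (m : ℕ) (hm : ∀ x ∈ U, x < m) (v : P)
    [Fintype {z : P // rk z = m ∧ p z ∧ z ≤ v}] :
    Nat.card (ChF rk p (insert m U) v) =
      ∑ z : {z : P // rk z = m ∧ p z ∧ z ≤ v}, Nat.card (ChF rk p U z.1) := by
  rw [← Nat.card_sigma]
  symm
  have hlt : ∀ (z : P) (C : Set P), C ∈ ChF rk p U z → ∀ x ∈ C, rk x < m := by
    intro z C hC x hx
    exact hm _ (by have : rk x ∈ rk '' C := ⟨x, hx, rfl⟩
                   rw [hC.2.1] at this; exact this)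
  have hfun : ∀ (z : P) (C : Set P), rk z = m ∧ p z ∧ z ≤ v → C ∈ ChF rk p U z →
      insert z C ∈ ChF rk p (insert m U) v := by
    rintro z C ⟨hz1, hz2, hz3⟩ ⟨hC1, hC2, hC3⟩
    refine ⟨hC1.insert fun b hb _ => Or.inr (hC3 b hb).2, ?_, ?_⟩
    · rw [Set.image_insert_eq, hC2, hz1]; simp
    · intro x hx
      rcases hx with rfl | hx
      · exact ⟨hz2, hz3⟩
      · exact ⟨(hC3 x hx).1, (hC3 x hx).2.trans hz3⟩
  let f : (Σ z : {z : P // rk z = m ∧ p z ∧ z ≤ v}, ChF rk p U z.1) →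
      ChF rk p (insert m U) v := fun q => ⟨insert q.1.1 q.2.1, hfun _ _ q.1.2 q.2.2⟩
  refine Nat.card_congr (Equiv.ofBijective f ⟨?_, ?_⟩)
  · rintro ⟨⟨z, hz⟩, C, hC⟩ ⟨⟨z', hz'⟩, C', hC'⟩ h
    have h : insert z C = insert z' C' := congrArg Subtype.val h
    have hzC : z ∉ C := fun hx => by have := hlt _ _ hC z hx; omega
    have hzC' : z' ∉ C' := fun hx => by have := hlt _ _ hC' z' hx; omega
    have e : z = z' := by
      have : z ∈ insert z' C' := h ▸ Set.mem_insert z C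
      rcases this with h1 | h1
      · exact h1
      · have := hlt _ _ hC' z h1; omega
    subst e
    have e2 : C = C' := by
      have := congrArg (fun A => A \ {z}) h
      simpa [hzC, hzC'] using this
    subst e2
    rfl
  · rintro ⟨C, hC1, hC2, hC3⟩
    have : m ∈ rk '' C := by rw [hC2]; simp
    obtain ⟨z, hz, hzm⟩ := this
    have hCz : insert z (C \ {z}) = C := by simp [Set.insert_eq_of_mem hz]
    refine ⟨⟨⟨z, hzm, hC3 z hz⟩, ⟨C \ {z}, hC1.mono Set.sdiff_subset, ?_, ?_⟩⟩, Subtype.ext hCz⟩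
    · ext y
      constructor
      · rintro ⟨x, ⟨hx, hxz⟩, rfl⟩
        have : rk x ∈ rk '' C := ⟨x, hx, rfl⟩
        rw [hC2] at this
        rcases Finset.mem_insert.1 (Finset.mem_coe.1 this) with h | h
        · exact absurd (chain_rk_inj hrk hC1 hx hz (h.trans hzm.symm)) hxz
        · exact h
      · intro hy
        have : y ∈ rk '' C := by rw [hC2]; exact Finset.mem_insert_of_mem hy
        obtain ⟨x, hx, rfl⟩ := this
        refine ⟨x, ⟨hx, ?_⟩, rfl⟩
        rintro rfl
        have := hm _ hy; omega
    · rintro x ⟨hx, _⟩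
      refine ⟨(hC3 x hx).1, chain_le_of_rk hrk hC1 hx hz ?_⟩
      change rk x ≤ rk z
      have : rk x ∈ rk '' C := ⟨x, hx, rfl⟩
      rw [hC2] at this
      rcases Finset.mem_insert.1 (Finset.mem_coe.1 this) with h | h
      · omega
      · have := hm _ h; omega

theorem maxChain_iff [OrderBot P] [OrderTop P] (rk : P → ℕ) (hrk : StrictMono rk) (N : ℕ)
    (hbot : rk ⊥ = 0) (htop : rk ⊤ = N)
    (hinterp : ∀ a b : P, ∀ m, a ≤ b → rk a ≤ m → m ≤ rk b → ∃ z, a ≤ z ∧ z ≤ b ∧ rk z = m)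
    (T : Finset ℕ) (hT : ∀ x ∈ T, x ≤ N) (C : Set P) :
    C ∈ maxChainsIn (rankSel rk T) ↔
      IsChain (· ≤ ·) C ∧ rk '' C = ↑(insert N (insert 0 T)) := by
  constructor
  · rintro ⟨h1, h2, h3⟩
    refine ⟨h2, ?_⟩
    have hins : ∀ z, z ∈ rankSel rk T → (∀ x ∈ C, x ≤ z ∨ z ≤ x) → z ∈ C := by
      intro z hz hx
      have := h3 (insert z C) (Set.insert_subset hz h1)
        (h2.insert fun b hb _ => (hx b hb).symm) (Set.subset_insert _ _)
      rw [this]; exact Set.mem_insert _ _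
    have hb : ⊥ ∈ C := hins ⊥ (by simp [rankSel]) (fun x _ => Or.inr bot_le)
    have ht : ⊤ ∈ C := hins ⊤ (by simp [rankSel]) (fun x _ => Or.inl le_top)
    apply Set.Subset.antisymm
    · rintro y ⟨x, hx, rfl⟩
      rcases h1 hx with h | h | h
      · simp only [Finset.coe_insert]; exact Or.inr (Or.inr h)
      · subst h; simp [hbot]
      · rw [Set.mem_singleton_iff.1 h, htop]; simp
    · intro m hm
      simp only [Finset.coe_insert, Set.mem_insert_iff, Finset.mem_coe] at hm
      rcases hm with rfl | rfl | hm
      · exact ⟨⊤, ht, htop⟩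
      · exact ⟨⊥, hb, hbot⟩
      -- elements just below and above rank m
      have hmN := hT m hm
      by_contra hc
      have hex1 : ∃ a ∈ C, rk a ≤ m ∧ ∀ x ∈ C, rk x ≤ m → rk x ≤ rk a := by
        have hne : (rk '' {x ∈ C | rk x ≤ m}).Nonempty := ⟨rk ⊥, ⊥, ⟨hb, by omega⟩, rfl⟩
        have hbd : BddAbove (rk '' {x ∈ C | rk x ≤ m}) := ⟨m, by rintro _ ⟨x, hx, rfl⟩; exact hx.2⟩
        obtain ⟨a, ha, ha'⟩ := Nat.sSup_mem hne hbd
        exact ⟨a, ha.1, ha.2, fun x hx hxm => ha' ▸ le_csSup hbd ⟨x, ⟨hx, hxm⟩, rfl⟩⟩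
      have hex2 : ∃ b ∈ C, m ≤ rk b ∧ ∀ x ∈ C, m ≤ rk x → rk b ≤ rk x := by
        have hne : (rk '' {x ∈ C | m ≤ rk x}).Nonempty := ⟨rk ⊤, ⊤, ⟨ht, by omega⟩, rfl⟩
        obtain ⟨b, hb, hb'⟩ := Nat.sInf_mem hne
        exact ⟨b, hb.1, hb.2, fun x hx hxm => hb' ▸ Nat.sInf_le ⟨x, ⟨hx, hxm⟩, rfl⟩⟩
      obtain ⟨a, ha1, ha2, ha3⟩ := hex1
      obtain ⟨b, hb1, hb2, hb3⟩ := hex2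
      obtain ⟨z, hz1, hz2, hz3⟩ := hinterp a b m (chain_le_of_rk hrk h2 ha1 hb1 (by omega)) ha2 hb2
      refine hc ⟨z, hins z (Or.inl (by simp [hz3, hm])) ?_, hz3⟩
      intro x hx
      rcases le_total (rk x) m with h | h
      · exact Or.inl ((chain_le_of_rk hrk h2 hx ha1 (ha3 x hx h)).trans hz1)
      · exact Or.inr (hz2.trans (chain_le_of_rk hrk h2 hb1 hx (hb3 x hx h)))
  · rintro ⟨h1, h2⟩
    have hb0 : ∀ x, rk x = 0 → x = ⊥ := by
      intro x hx
      by_contra hc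
      have := hrk (bot_lt_iff_ne_bot.2 hc)
      omega
    have htN : ∀ x, rk x = N → x = ⊤ := by
      intro x hx
      by_contra hc
      have := hrk (lt_top_iff_ne_top.2 hc)
      omega
    refine ⟨?_, h1, ?_⟩
    · intro x hx
      have : rk x ∈ rk '' C := ⟨x, hx, rfl⟩
      rw [h2] at this
      simp only [Finset.coe_insert, Set.mem_insert_iff, Finset.mem_coe] at this
      rcases this with h | h | h
      · exact Or.inr (Or.inr (htN x h))
      · exact Or.inr (Or.inl (hb0 x h))
      · exact Or.inl h
    · intro D hD1 hD2 hCD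
      refine hCD.antisymm fun d hd => ?_
      have : rk d ∈ rk '' C := by
        rw [h2]
        simp only [Finset.coe_insert, Set.mem_insert_iff, Finset.mem_coe]
        rcases hD1 hd with h | h | h
        · exact Or.inr (Or.inr h)
        · subst h; exact Or.inr (Or.inl hbot)
        · rw [Set.mem_singleton_iff.1 h]; exact Or.inl htop
      obtain ⟨c, hc, hcd⟩ := this
      rw [← chain_rk_inj hrk hD2 (hCD hc) hd hcd]; exact hc

theorem image_eq_iff_fixed (rk : P → ℕ) (hrk : StrictMono rk) (a : P → P)
    (ha : ∀ x, rk (a x) = rk x) (C : Set P) (hC : IsChain (· ≤ ·) C) :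
    a '' C = C ↔ ∀ x ∈ C, a x = x := by
  constructor
  · intro h x hx
    have : a x ∈ C := h ▸ ⟨x, hx, rfl⟩
    exact chain_rk_inj hrk hC this hx (ha x)
  · intro h
    ext y
    constructor
    · rintro ⟨x, hx, rfl⟩; rw [h x hx]; exact hx
    · intro hy; exact ⟨y, hy, h y hy⟩

end chains

theorem chM_insert_zero (T : Finset ℕ) : ∀ t, (∀ x ∈ T, 0 < x) → chM (insert 0 T) t = chM T t := by
  induction T using Finset.induction_on_max with
  | empty => intro t _; rw [chM_insert _ _ _ (by simp)]; simp [chM_empty]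
  | insert m T hm ih =>
    intro t h
    have h0 : 0 < m := h m (Finset.mem_insert_self _ _)
    rw [Finset.insert_comm, chM_insert _ _ _ hm, chM_insert, ih m]
    · intro x hx; exact h x (Finset.mem_insert_of_mem hx)
    · intro x hx
      rcases Finset.mem_insert.1 hx with rfl | hx
      · exact h0
      · exact hm x hx


theorem sublist_interp {α : Type} {l1 l2 : List α} (h : l1.Sublist l2) : ∀ m, l1.length ≤ m →
    m ≤ l2.length → ∃ l : List α, l1.Sublist l ∧ l.Sublist l2 ∧ l.length = m := by
  induction h with
  | slnil => intro m h1 h2; simp at h2; exact ⟨[], by simp, by simp, by simp [h2]⟩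
  | @cons l1 l2 a h ih =>
    intro m h1 h2
    by_cases hm : m ≤ l2.length
    · obtain ⟨l, ha, hb, hc⟩ := ih m h1 hm
      exact ⟨l, ha, hb.cons _, hc⟩
    · refine ⟨a :: l2, h.cons _, List.Sublist.refl _, ?_⟩
      simp at h2 ⊢; omega
  | @cons_cons l1 l2 a h ih =>
    intro m h1 h2
    simp at h1 h2
    obtain ⟨l, ha, hb, hc⟩ := ih (m - 1) (by omega) (by omega)
    exact ⟨a :: l, ha.cons_cons _, hb.cons_cons _, by simp; omega⟩

/-- make a word -/
def mkW {n r : ℕ} (l : List (Fin n × ZMod r)) (h : (l.map Prod.fst).Nodup) : CInjWord n r := ⟨l, h⟩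

theorem mkW_coe_inj {n r : ℕ} {l l' : List (Fin n × ZMod r)} {h : (l.map Prod.fst).Nodup}
    {h' : (l'.map Prod.fst).Nodup}
    (e : (mkW l h : WithTop (CInjWord n r)) = (mkW l' h' : WithTop (CInjWord n r))) : l = l' := by
  have := WithTop.coe_inj.1 e
  have : (mkW l h).1 = (mkW l' h').1 := by rw [this]
  exact this

theorem word_extend {n r : ℕ} (u : CInjWord n r) (m : ℕ) (h1 : u.1.length ≤ m) (h2 : m ≤ n) :
    ∃ z : CInjWord n r, u ≤ z ∧ z.1.length = m := by
  obtain ⟨l, hl⟩ := u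
  simp only at h1
  set A := (l.map Prod.fst).toFinset with hA
  have hAc : A.card = l.length := by
    rw [hA, List.toFinset_card_of_nodup hl]; simp
  have hc : (Finset.univ \ A).toList.length = n - l.length := by
    rw [Finset.length_toList, Finset.card_sdiff_of_subset (Finset.subset_univ _), hAc]; simp
  refine ⟨⟨l ++ ((Finset.univ \ A).toList.take (m - l.length)).map (fun x => (x, (0 : ZMod r))),
    ?_⟩, ?_, ?_⟩
  · rw [List.map_append, List.map_map]
    have e : (Prod.fst ∘ fun x : Fin n => (x, (0 : ZMod r))) = id := rfl
    rw [e, List.map_id, List.nodup_append]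
    refine ⟨hl, (List.take_sublist _ _).nodup (Finset.nodup_toList _), ?_⟩
    rintro a ha b hb rfl
    have := (List.take_sublist _ _).subset hb
    rw [Finset.mem_toList, Finset.mem_sdiff, hA, List.mem_toFinset] at this
    exact this.2 ha
  · exact List.sublist_append_left _ _
  · simp only [List.length_append, List.length_map, List.length_take, hc]; omega

theorem word_length_le {n r : ℕ} (u : CInjWord n r) : u.1.length ≤ n := by
  have := List.Nodup.length_le_card u.2
  simpa using this

instance cinjFinite {n r : ℕ} [NeZero r] : Finite (CInjWord n r) := by
  have : Set.Finite {l : List (Fin n × ZMod r) | l.length ≤ n} := List.finite_length_le _ _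
  have := this.to_subtype
  exact Finite.of_injective
    (fun u : CInjWord n r => (⟨u.1, word_length_le u⟩ : {l : List (Fin n × ZMod r) | l.length ≤ n}))
    (fun a b h => Subtype.ext (by simpa using h))

theorem rkC_coe {n r : ℕ} (u : CInjWord n r) : rkC n r (u : WithTop (CInjWord n r)) = u.1.length :=
  rfl

theorem rkC_top {n r : ℕ} : rkC n r ⊤ = n + 1 := rfl

theorem rkC_strictMono {n r : ℕ} : StrictMono (rkC n r) := by
  intro a b h
  induction b using WithTop.recTopCoe with
  | top =>
    induction a using WithTop.recTopCoe with
    | top => exact absurd h (lt_irrefl _)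
    | coe a => rw [rkC_coe, rkC_top]; have := word_length_le a; omega
  | coe b =>
    induction a using WithTop.recTopCoe with
    | top => exact absurd h (by simp)
    | coe a =>
      rw [rkC_coe, rkC_coe]
      have h := WithTop.coe_lt_coe.1 h
      have h1 : a.1.Sublist b.1 := h.le
      rcases h1.length_le.eq_or_lt with h2 | h2
      · exact absurd (Subtype.ext (h1.eq_of_length h2)) h.ne
      · exact h2

theorem rkC_interp {n r : ℕ} (a b : WithTop (CInjWord n r)) (m : ℕ) (hab : a ≤ b)
    (h1 : rkC n r a ≤ m) (h2 : m ≤ rkC n r b) : ∃ z, a ≤ z ∧ z ≤ b ∧ rkC n r z = m := by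
  induction b using WithTop.recTopCoe with
  | top =>
    rw [rkC_top] at h2
    by_cases hm : m = n + 1
    · exact ⟨⊤, le_top, le_rfl, by rw [rkC_top, hm]⟩
    induction a using WithTop.recTopCoe with
    | top => rw [rkC_top] at h1; omega
    | coe a =>
      obtain ⟨z, hz1, hz2⟩ := word_extend a m h1 (by omega)
      exact ⟨z, WithTop.coe_le_coe.2 hz1, le_top, hz2⟩
  | coe b =>
    induction a using WithTop.recTopCoe with
    | top => exact absurd hab (by simp)
    | coe a =>
      obtain ⟨l, ha, hb, hc⟩ := sublist_interp (WithTop.coe_le_coe.1 hab) m h1 h2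
      exact ⟨((mkW l ((hb.map _).nodup b.2)) : WithTop (CInjWord n r)),
        WithTop.coe_le_coe.2 ha, WithTop.coe_le_coe.2 hb, hc⟩

/-- fixed elements -/
def fixP (n r : ℕ) (g : Equiv.Perm (Fin n)) (x : WithTop (CInjWord n r)) : Prop :=
  WithTop.map (permCWord g) x = x

theorem fixP_coe {n r : ℕ} (g : Equiv.Perm (Fin n)) (u : CInjWord n r) :
    fixP n r g u ↔ ∀ p ∈ u.1, g p.1 = p.1 := by
  unfold fixP
  rw [WithTop.map_coe, WithTop.coe_inj]
  refine Iff.trans ⟨fun h => congrArg Subtype.val h, fun h => Subtype.ext h⟩ ?_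
  change u.1.map (fun p => (g p.1, p.2)) = u.1 ↔ _
  have hh : u.1.map (fun p => (g p.1, p.2)) = u.1 ↔ ∀ p ∈ u.1, (g p.1, p.2) = p := by
    conv_lhs => rhs; rw [← List.map_id u.1]
    rw [List.map_inj_left]
    rfl
  rw [hh]
  refine forall₂_congr fun p _ => ?_
  simp [Prod.ext_iff]

theorem fixP_top {n r : ℕ} (g : Equiv.Perm (Fin n)) : fixP n r g ⊤ := rfl

theorem card_below {n r : ℕ} (g : Equiv.Perm (Fin n)) (u : CInjWord n r)
    (hu : fixP n r g u) (m : ℕ) :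
    Nat.card {z : WithTop (CInjWord n r) // rkC n r z = m ∧ fixP n r g z ∧ z ≤ u} =
      u.1.length.choose m := by
  have hnd : u.1.Nodup := List.Nodup.of_map _ u.2
  have e : {z : WithTop (CInjWord n r) // rkC n r z = m ∧ fixP n r g z ∧ z ≤ u} ≃
      (u.1.sublistsLen m).toFinset := by
    symm
    have hs : ∀ l ∈ (u.1.sublistsLen m).toFinset, l.Sublist u.1 ∧ l.length = m := by
      intro l hl
      simpa using hl
    refine Equiv.ofBijective (fun l => ⟨((mkW l.1 (((hs l.1 l.2).1.map _).nodup u.2) : CInjWord n r) :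
      WithTop (CInjWord n r)), (hs l.1 l.2).2, ?_, WithTop.coe_le_coe.2 (hs l.1 l.2).1⟩) ⟨?_, ?_⟩
    · rw [fixP_coe] at hu ⊢
      intro p hp
      exact hu p ((hs l.1 l.2).1.subset hp)
    · intro a b hab
      have := congrArg Subtype.val hab
      exact Subtype.ext (mkW_coe_inj this)
    · rintro ⟨z, h1, h2, h3⟩
      induction z using WithTop.recTopCoe with
      | top => exact absurd h3 (by simp)
      | coe z =>
        refine ⟨⟨z.1, ?_⟩, rfl⟩
        simp only [List.mem_toFinset, List.mem_sublistsLen]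
        exact ⟨WithTop.coe_le_coe.1 h3, h1⟩
  rw [Nat.card_congr e, Nat.card_eq_fintype_card, Fintype.card_coe,
    List.toFinset_card_of_nodup (List.nodup_sublistsLen _ hnd), List.length_sublistsLen]

theorem card_ChF_word {n r : ℕ} [NeZero r] (g : Equiv.Perm (Fin n)) (U : Finset ℕ) :
    ∀ (u : CInjWord n r), fixP n r g u →
    Nat.card (ChF (rkC n r) (fixP n r g) U (u : WithTop (CInjWord n r))) = chM U u.1.length := by
  induction U using Finset.induction_on_max with
  | empty => intro u _; rw [card_ChF_empty, chM_empty]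
  | insert m U hm ih =>
    intro u hu
    have : Finite (WithTop (CInjWord n r)) := inferInstanceAs (Finite (Option (CInjWord n r)))
    let _ : Fintype {z : WithTop (CInjWord n r) // rkC n r z = m ∧ fixP n r g z ∧ z ≤ u} :=
      Fintype.ofFinite _
    rw [card_ChF_insert _ rkC_strictMono _ _ _ hm, chM_insert _ _ _ hm, ← card_below g u hu m,
      Nat.card_eq_fintype_card, ← smul_eq_mul, ← Finset.card_univ, ← Finset.sum_const]
    refine Finset.sum_congr rfl ?_
    rintro ⟨z, h1, h2, h3⟩ _
    induction z using WithTop.recTopCoe with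
    | top => exact absurd h3 (by simp)
    | coe z =>
      rw [ih z h2]
      congr 1

/-- injective words of length `m` fixed by `g`, as embeddings -/
theorem card_fixed_words {n r : ℕ} [NeZero r] (g : Equiv.Perm (Fin n)) (m : ℕ) (hm : m ≤ n) :
    Nat.card {z : WithTop (CInjWord n r) // rkC n r z = m ∧ fixP n r g z ∧ z ≤ ⊤} =
      r ^ m * Nat.card {u : Fin m ↪ Fin n // ∀ i, g (u i) = u i} := by
  have e : {u : Fin m ↪ Fin n // ∀ i, g (u i) = u i} × (Fin m → ZMod r) ≃
    {z : WithTop (CInjWord n r) // rkC n r z = m ∧ fixP n r g z ∧ z ≤ ⊤} := by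
    have hnd : ∀ (u : Fin m ↪ Fin n) (c : Fin m → ZMod r),
        ((List.ofFn fun i => (u i, c i)).map Prod.fst).Nodup := by
      intro u c
      rw [List.map_ofFn, List.nodup_ofFn]
      exact u.injective
    refine Equiv.ofBijective (fun q => ⟨((mkW (List.ofFn fun i => (q.1.1 i, q.2 i)) (hnd q.1.1 q.2) :
      CInjWord n r) : WithTop (CInjWord n r)), ?_, ?_, le_top⟩) ⟨?_, ?_⟩
    · rw [rkC_coe]; exact List.length_ofFn
    · rw [fixP_coe]
      intro p hp
      have hp : p ∈ List.ofFn fun i => (q.1.1 i, q.2 i) := hp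
      rw [List.mem_ofFn] at hp
      obtain ⟨i, rfl⟩ := hp
      exact q.1.2 i
    · rintro ⟨⟨u, hu⟩, c⟩ ⟨⟨u', hu'⟩, c'⟩ h
      have := congrArg Subtype.val h
      have := mkW_coe_inj this
      have := List.ofFn_injective this
      have h1 : u = u' := by ext i : 1; exact congrArg Prod.fst (congrFun this i)
      have h2 : c = c' := by ext i : 1; exact congrArg Prod.snd (congrFun this i)
      subst h1; subst h2; rfl
    · rintro ⟨z, h1, h2, h3⟩
      induction z using WithTop.recTopCoe with
      | top => rw [rkC_top] at h1; omega
      | coe z =>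
        rw [rkC_coe] at h1
        rw [fixP_coe] at h2
        obtain ⟨l, hl⟩ := z
        have h1 : l.length = m := h1
        have h2 : ∀ p ∈ l, g p.1 = p.1 := h2
        subst h1
        refine ⟨⟨⟨⟨fun i => (l.get i).1, ?_⟩, ?_⟩, fun i => (l.get i).2⟩, ?_⟩
        · intro i j hij
          have := List.nodup_iff_injective_get.1 hl
          have := @this (i.cast (by simp)) (j.cast (by simp)) (by simpa using hij)
          simpa [Fin.ext_iff] using this
        · intro i
          exact h2 _ (List.get_mem _ _)
        · apply Subtype.ext
          apply WithTop.coe_inj.2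
          apply Subtype.ext
          exact List.ofFn_get l
  rw [← Nat.card_congr e, Nat.card_prod, mul_comm]
  congr 1
  rw [Nat.card_eq_fintype_card]
  simp [ZMod.card]

theorem rkC_map {n r : ℕ} (g : Equiv.Perm (Fin n)) (x : WithTop (CInjWord n r)) :
    rkC n r (WithTop.map (permCWord g) x) = rkC n r x := by
  induction x using WithTop.recTopCoe with
  | top => rfl
  | coe x => rw [WithTop.map_coe, rkC_coe, rkC_coe]; simp [permCWord]

theorem rkC_bot {n r : ℕ} : rkC n r ⊥ = 0 := rfl

theorem cAlpha_eq_ChF {n r : ℕ} [NeZero r] (T : Finset ℕ) (hT : ∀ x ∈ T, 0 < x ∧ x ≤ n)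
    (g : Equiv.Perm (Fin n)) :
    cAlpha n r T g = (Nat.card (ChF (rkC n r) (fixP n r g) (insert 0 T) ⊤) : ℤ) := by
  have : Finite (WithTop (CInjWord n r)) := inferInstanceAs (Finite (Option (CInjWord n r)))
  unfold cAlpha gAlpha
  have e : {C : Set (WithTop (CInjWord n r)) | C ∈ maxChainsIn (rankSel (rkC n r) T) ∧
      WithTop.map (permCWord g) '' C = C} =
      ChF (rkC n r) (fixP n r g) (insert (n + 1) (insert 0 T)) ⊤ := by
    ext C
    constructor
    · rintro ⟨h1, h2⟩
      rw [maxChain_iff (rkC n r) rkC_strictMono (n + 1) rkC_bot rkC_top rkC_interp T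
        (fun x hx => by have := hT x hx; omega)] at h1
      refine ⟨h1.1, h1.2, fun x hx => ⟨?_, le_top⟩⟩
      exact (image_eq_iff_fixed (rkC n r) rkC_strictMono _ (rkC_map g) C h1.1).1 h2 x hx
    · rintro ⟨h1, h2, h3⟩
      refine ⟨(maxChain_iff (rkC n r) rkC_strictMono (n + 1) rkC_bot rkC_top rkC_interp T
        (fun x hx => by have := hT x hx; omega) C).2 ⟨h1, h2⟩, ?_⟩
      exact (image_eq_iff_fixed (rkC n r) rkC_strictMono _ (rkC_map g) C h1).2
        fun x hx => (h3 x hx).1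
  change (Set.ncard {C : Set (WithTop (CInjWord n r)) | C ∈ maxChainsIn (rankSel (rkC n r) T) ∧
      WithTop.map (permCWord g) '' C = C} : ℤ) = _
  rw [e]
  rw [← Nat.card_coe_set_eq]
  let _ : Fintype {z : WithTop (CInjWord n r) // rkC n r z = n + 1 ∧ fixP n r g z ∧ z ≤ ⊤} :=
    Fintype.ofFinite _
  rw [card_ChF_insert _ rkC_strictMono _ _ _ (by
    intro x hx
    rcases Finset.mem_insert.1 hx with rfl | hx
    · omega
    · have := hT x hx; omega)]
  rw [Fintype.sum_eq_single ⟨⊤, rkC_top, fixP_top g, le_rfl⟩]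
  rintro ⟨z, h1, h2, h3⟩ hne
  exfalso
  apply hne
  apply Subtype.ext
  by_contra hc
  have := rkC_strictMono (lt_top_iff_ne_top.2 hc)
  rw [rkC_top] at this
  simp only at this
  omega

theorem cAlpha_empty {n r : ℕ} [NeZero r] (g : Equiv.Perm (Fin n)) : cAlpha n r ∅ g = 1 := by
  have : Finite (WithTop (CInjWord n r)) := inferInstanceAs (Finite (Option (CInjWord n r)))
  rw [cAlpha_eq_ChF ∅ (by simp)]
  let _ : Fintype {z : WithTop (CInjWord n r) // rkC n r z = 0 ∧ fixP n r g z ∧ z ≤ ⊤} :=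
    Fintype.ofFinite _
  rw [card_ChF_insert _ rkC_strictMono _ _ _ (by simp)]
  simp only [card_ChF_empty, Finset.sum_const, Finset.card_univ, ← Nat.card_eq_fintype_card,
    card_fixed_words g 0 (Nat.zero_le _)]
  simp

theorem cAlpha_insert {n r : ℕ} [NeZero r] (T : Finset ℕ) (m : ℕ) (hT : ∀ x ∈ T, 0 < x ∧ x < m)
    (hm : 0 < m) (hmn : m ≤ n) (g : Equiv.Perm (Fin n)) : cAlpha n r (insert m T) g =
      (chM T m : ℤ) * r ^ m * Nat.card {u : Fin m ↪ Fin n // ∀ i, g (u i) = u i} := by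
  have : Finite (WithTop (CInjWord n r)) := inferInstanceAs (Finite (Option (CInjWord n r)))
  rw [cAlpha_eq_ChF]
  swap
  · intro x hx
    rcases Finset.mem_insert.1 hx with rfl | hx
    · exact ⟨hm, hmn⟩
    · have := hT x hx; omega
  let _ : Fintype {z : WithTop (CInjWord n r) // rkC n r z = m ∧ fixP n r g z ∧ z ≤ ⊤} :=
    Fintype.ofFinite _
  rw [Finset.insert_comm, card_ChF_insert _ rkC_strictMono _ _ _ (by
    intro x hx
    rcases Finset.mem_insert.1 hx with rfl | hx
    · omega
    · have := hT x hx; omega)]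
  have : ∀ z : {z : WithTop (CInjWord n r) // rkC n r z = m ∧ fixP n r g z ∧ z ≤ ⊤},
      Nat.card (ChF (rkC n r) (fixP n r g) (insert 0 T) z.1) = chM T m := by
    rintro ⟨z, h1, h2, h3⟩
    induction z using WithTop.recTopCoe with
    | top => rw [rkC_top] at h1; omega
    | coe z =>
      rw [card_ChF_word g _ z h2, chM_insert_zero _ _ (fun x hx => (hT x hx).1)]
      rw [rkC_coe] at h1
      rw [h1]
  rw [Finset.sum_congr rfl fun z _ => this z, Finset.sum_const, Finset.card_univ,
    ← Nat.card_eq_fintype_card, card_fixed_words g m hmn]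
  simp only [smul_eq_mul]
  push_cast
  ring


/-- words with letters in `Fin L` bounded multiplicities -/
noncomputable def wN {L : ℕ} (c : Fin L → ℤ) (t : ℕ) : ℕ :=
  Nat.card {v : Fin t → Fin L // ∀ i, ((Finset.univ.filter fun j => v j = i).card : ℤ) ≤ c i}

/-- pairs of an embedding and a function of given type -/
def YX (n t L : ℕ) (c : Fin L → ℤ) : Type :=
  {p : (Fin t ↪ Fin n) × (Fin n → Fin L) // ∀ i, ((Nat.card {x : Fin n // p.2 x = i} : ℕ) : ℤ) = c i}

noncomputable instance YXfin (n t L : ℕ) (c : Fin L → ℤ) : Fintype (YX n t L c) := by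
  unfold YX; infer_instance

theorem card_comp_perm {n L : ℕ} (f : Fin n → Fin L) (g : Equiv.Perm (Fin n)) (i : Fin L) :
    Nat.card {x : Fin n // f (g x) = i} = Nat.card {x : Fin n // f x = i} :=
  Nat.card_congr (g.subtypeEquiv fun _ => Iff.rfl)

instance YXact (n t L : ℕ) (c : Fin L → ℤ) : MulAction (Equiv.Perm (Fin n)) (YX n t L c) where
  smul g p := ⟨(p.1.1.trans g.toEmbedding, fun x => p.1.2 (g⁻¹ x)), fun i => by
    rw [← p.2 i]; exact congrArg _ (card_comp_perm _ _ _)⟩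
  one_smul p := rfl
  mul_smul g h p := rfl

theorem YX_smul_fst {n t L : ℕ} {c : Fin L → ℤ} (g : Equiv.Perm (Fin n)) (p : YX n t L c) (j : Fin t) :
    (g • p).1.1 j = g (p.1.1 j) := rfl
theorem YX_smul_snd {n t L : ℕ} {c : Fin L → ℤ} (g : Equiv.Perm (Fin n)) (p : YX n t L c) (x : Fin n) :
    (g • p).1.2 x = p.1.2 (g⁻¹ x) := rfl

theorem YX_ext {n t L : ℕ} {c : Fin L → ℤ} {p q : YX n t L c} (h1 : ∀ j, p.1.1 j = q.1.1 j)
    (h2 : ∀ x, p.1.2 x = q.1.2 x) : p = q := by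
  apply Subtype.ext
  apply Prod.ext
  · ext j : 1; exact h1 j
  · ext x : 1; exact h2 x

theorem card_fixedBy_YX {n t L : ℕ} (c : Fin L → ℤ) (g : Equiv.Perm (Fin n)) :
    Nat.card (MulAction.fixedBy (YX n t L c) g) =
      Nat.card {u : Fin t ↪ Fin n // ∀ i, g (u i) = u i} * fixedYoungFns n L c g⁻¹ := by
  unfold fixedYoungFns
  rw [← Nat.card_prod]
  apply Nat.card_congr
  refine ⟨fun p => ⟨⟨p.1.1.1, fun i => ?_⟩, ⟨p.1.1.2, fun x => ?_, p.1.2⟩⟩,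
    fun q => ⟨⟨(q.1.1, q.2.1), q.2.2.2⟩, ?_⟩, fun p => rfl, fun q => rfl⟩
  · have := p.2
    rw [MulAction.mem_fixedBy] at this
    rw [← YX_smul_fst, this]
  · have := p.2
    rw [MulAction.mem_fixedBy] at this
    rw [← YX_smul_snd, this]
  · let y : YX n t L c := ⟨(q.1.1, q.2.1), q.2.2.2⟩
    exact YX_ext (p := g • y) (q := y) q.1.2 q.2.2.1

theorem exists_perm_fibers {n : ℕ} {β : Type} [Fintype β] (F F' : Fin n → β)
    (h : ∀ b, (Finset.univ.filter fun x => F' x = b).card = (Finset.univ.filter fun x => F x = b).card) :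
    ∃ g : Equiv.Perm (Fin n), ∀ x, F (g x) = F' x := by
  have : ∀ b, Nonempty ({x // F' x = b} ≃ {x // F x = b}) := by
    intro b
    rw [← Fintype.card_eq, Fintype.card_subtype, Fintype.card_subtype, h b]
  refine ⟨Equiv.ofFiberEquiv fun b => (this b).some, fun x => ?_⟩
  exact Equiv.ofFiberEquiv_map _ x

theorem fiber_count {n t L : ℕ} (u : Fin t ↪ Fin n) (f : Fin n → Fin L) (i : Fin L) :
    (Finset.univ.filter fun x => f x = i).card =
      (Finset.univ.filter fun x => (f x, Function.partialInv u x) = (i, none)).card +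
      (Finset.univ.filter fun j => f (u j) = i).card ∧
    ∀ j, (Finset.univ.filter fun x => (f x, Function.partialInv u x) = (i, some j)).card =
      if f (u j) = i then 1 else 0 := by
  have hp : ∀ j x, Function.partialInv u x = some j ↔ u j = x :=
    Function.Injective.isPartialInv u.injective
  have h2 : ∀ j, (Finset.univ.filter fun x => (f x, Function.partialInv u x) = (i, some j)).card =
      if f (u j) = i then 1 else 0 := by
    intro j
    split_ifs with h
    · rw [Finset.card_eq_one]
      refine ⟨u j, ?_⟩
      ext x
      simp only [Finset.mem_filter, Finset.mem_univ, true_and, Prod.mk.injEq, hp,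
        Finset.mem_singleton]
      constructor
      · rintro ⟨_, rfl⟩; rfl
      · rintro rfl; exact ⟨h, rfl⟩
    · rw [Finset.card_eq_zero, Finset.filter_eq_empty_iff]
      intro x _ hx
      simp only [Prod.mk.injEq, hp] at hx
      obtain ⟨hx, rfl⟩ := hx
      exact h hx
  refine ⟨?_, h2⟩
  rw [Finset.card_eq_sum_card_fiberwise (f := fun x => Function.partialInv u x)
    (t := Finset.univ) (fun _ _ => Finset.mem_coe.2 (Finset.mem_univ _)), Fintype.sum_option]
  simp only [Finset.filter_filter]
  congr 1
  · congr 1; ext x; simp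
  · rw [Finset.card_filter]
    refine Finset.sum_congr rfl fun j _ => ?_
    rw [← h2 j]
    congr 1; ext x; simp

theorem YX_orbit {n t L : ℕ} {c : Fin L → ℤ} (p q : YX n t L c)
    (h : ∀ j, p.1.2 (p.1.1 j) = q.1.2 (q.1.1 j)) : ∃ g : Equiv.Perm (Fin n), g • q = p := by
  have hc : ∀ i, (Finset.univ.filter fun x => q.1.2 x = i).card =
      (Finset.univ.filter fun x => p.1.2 x = i).card := by
    intro i
    have h1 := p.2 i
    have h2 := q.2 i
    rw [Nat.card_eq_fintype_card, Fintype.card_subtype] at h1 h2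
    have := h1.trans h2.symm
    exact_mod_cast this.symm
  obtain ⟨g, hg⟩ := exists_perm_fibers (fun x => (p.1.2 x, Function.partialInv p.1.1 x))
    (fun x => (q.1.2 x, Function.partialInv q.1.1 x)) (by
      rintro ⟨i, o⟩
      obtain ⟨a1, a2⟩ := fiber_count p.1.1 p.1.2 i
      obtain ⟨b1, b2⟩ := fiber_count q.1.1 q.1.2 i
      cases o with
      | some j =>
        have := (b2 j).trans ((by rw [h j] : _ = _).trans (a2 j).symm)
        convert this
      | none =>
        have := hc i
        simp only [h] at a1
        rw [this, a1] at b1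
        have := (Nat.add_right_cancel b1).symm
        convert this)
  refine ⟨g, YX_ext (fun j => ?_) fun x => ?_⟩
  · rw [YX_smul_fst]
    have := congrArg Prod.snd (hg (q.1.1 j))
    simp only at this
    have e : Function.partialInv q.1.1 (q.1.1 j) = some j :=
      (Function.Injective.isPartialInv q.1.1.injective _ _).2 rfl
    rw [e] at this
    exact ((Function.Injective.isPartialInv p.1.1.injective _ _).1 this).symm
  · rw [YX_smul_snd]
    have := congrArg Prod.fst (hg (g⁻¹ x))
    simp only at this
    rw [← this]
    simp

theorem YX_surj {n t L : ℕ} {c : Fin L → ℤ} (hc : ∑ i, c i = n) (v : Fin t → Fin L)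
    (hv : ∀ i, ((Finset.univ.filter fun j => v j = i).card : ℤ) ≤ c i) :
    ∃ p : YX n t L c, ∀ j, p.1.2 (p.1.1 j) = v j := by
  have h0 : ∀ i, 0 ≤ c i := fun i => le_trans (by positivity) (hv i)
  have hcard : Fintype.card (Σ i, Fin (c i).toNat) = Fintype.card (Fin n) := by
    simp only [Fintype.card_sigma, Fintype.card_fin]
    zify
    rw [← hc]
    exact Finset.sum_congr rfl fun i _ => Int.toNat_of_nonneg (h0 i)
  obtain ⟨e⟩ := Fintype.card_eq.1 hcard
  have ha : ∀ i, Nonempty ({j // v j = i} ↪ Fin (c i).toNat) := by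
    intro i
    apply Function.Embedding.nonempty_of_card_le
    rw [Fintype.card_subtype, Fintype.card_fin]
    have := hv i
    have := h0 i
    omega
  refine ⟨⟨(⟨fun j => e ⟨v j, (ha (v j)).some ⟨j, rfl⟩⟩, ?_⟩, fun x => (e.symm x).1), ?_⟩, ?_⟩
  · intro j j' hjj
    have := e.injective hjj
    have aux : ∀ i i' (x : {j // v j = i}) (x' : {j // v j = i'}),
        (⟨i, (ha i).some x⟩ : Σ i, Fin (c i).toNat) = ⟨i', (ha i').some x'⟩ → x.1 = x'.1 := by
      intro i i' x x' hx
      obtain ⟨h1, h2⟩ := Sigma.mk.inj_iff.1 hx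
      subst h1
      have := (ha i).some.injective (eq_of_heq h2)
      rw [this]
    exact aux _ _ _ _ this
  · intro i
    have : {x : Fin n // (e.symm x).1 = i} ≃ Fin (c i).toNat :=
      (e.symm.subtypeEquiv (q := fun s => s.1 = i) fun _ => Iff.rfl).trans (Equiv.sigmaSubtype i)
    change ((Nat.card {x : Fin n // (e.symm x).1 = i} : ℕ) : ℤ) = c i
    rw [Nat.card_congr this]
    simp [h0 i]
  · intro j
    change (e.symm (e _)).1 = v j
    rw [Equiv.symm_apply_apply]

theorem burnside_YX {n t L : ℕ} {c : Fin L → ℤ} (hc : ∑ i, c i = n) :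
    ∑ g : Equiv.Perm (Fin n), Nat.card {u : Fin t ↪ Fin n // ∀ i, g (u i) = u i} *
      fixedYoungFns n L c g⁻¹ = wN c t * n.factorial := by
  have hB := MulAction.sum_card_fixedBy_eq_card_orbits_mul_card_group (Equiv.Perm (Fin n))
    (YX n t L c)
  rw [Fintype.card_perm, Fintype.card_fin] at hB
  have e : MulAction.orbitRel.Quotient (Equiv.Perm (Fin n)) (YX n t L c) ≃
      {v : Fin t → Fin L // ∀ i, ((Finset.univ.filter fun j => v j = i).card : ℤ) ≤ c i} := by
    have hle : ∀ (p : YX n t L c) (i), ((Finset.univ.filter fun j => p.1.2 (p.1.1 j) = i).card : ℤ) ≤ c i := by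
      intro p i
      have h1 := p.2 i
      rw [Nat.card_eq_fintype_card, Fintype.card_subtype] at h1
      have := (fiber_count p.1.1 p.1.2 i).1
      omega
    refine Equiv.ofBijective (Quotient.lift (fun p : YX n t L c =>
      ⟨fun j => p.1.2 (p.1.1 j), hle p⟩) ?_) ⟨?_, ?_⟩
    · intro p q hpq
      obtain ⟨g, rfl⟩ := MulAction.orbitRel_apply.1 hpq
      apply Subtype.ext
      funext j
      change (g • q).1.2 ((g • q).1.1 j) = _
      rw [YX_smul_snd, YX_smul_fst]
      simp
    · intro p q
      refine Quotient.inductionOn₂ p q fun p q h => ?_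
      have h1 : (fun j => p.1.2 (p.1.1 j)) = fun j => q.1.2 (q.1.1 j) := congrArg Subtype.val h
      apply Quotient.sound
      exact YX_orbit p q (congrFun h1)
    · rintro ⟨v, hv⟩
      obtain ⟨p, hp⟩ := YX_surj hc v hv
      exact ⟨Quotient.mk _ p, Subtype.ext (funext hp)⟩
  rw [← Nat.card_eq_fintype_card (α := Quotient _)] at hB
  unfold wN
  rw [← Nat.card_congr e]
  refine Eq.trans ?_ hB
  refine Finset.sum_congr rfl fun g _ => ?_
  rw [← card_fixedBy_YX, Nat.card_eq_fintype_card]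


theorem wN_succ {L : ℕ} (c : Fin L → ℤ) (t : ℕ) :
    wN c (t + 1) = ∑ i, wN (fun k => c k - if k = i then 1 else 0) t := by
  unfold wN
  have e : {v : Fin (t + 1) → Fin L // ∀ i, ((Finset.univ.filter fun j => v j = i).card : ℤ) ≤ c i} ≃
      Σ i : Fin L, {v : Fin t → Fin L // ∀ k, ((Finset.univ.filter fun j => v j = k).card : ℤ) ≤
        c k - if k = i then 1 else 0} := by
    have key : ∀ (i : Fin L) (v : Fin t → Fin L) (k : Fin L),
        ((Finset.univ.filter fun j => (Fin.cons i v : Fin (t + 1) → Fin L) j = k).card : ℤ) ≤ c k ↔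
        ((Finset.univ.filter fun j => v j = k).card : ℤ) ≤ c k - if k = i then 1 else 0 := by
      intro i v k
      rw [Fin.card_filter_univ_succ]
      simp only [Fin.cons_zero, Fin.cons_succ, eq_comm (a := i)]
      split_ifs <;> push_cast <;> omega
    refine ⟨fun v => ⟨v.1 0, ⟨fun j => v.1 j.succ, fun k => ?_⟩⟩,
      fun s => ⟨Fin.cons s.1 s.2.1, fun k => (key _ _ _).2 (s.2.2 k)⟩, fun v => ?_, fun s => ?_⟩
    · rw [← key]
      have : (Fin.cons (v.1 0) fun j => v.1 j.succ : Fin (t + 1) → Fin L) = v.1 :=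
        Fin.cons_self_tail v.1
      rw [this]
      exact v.2 k
    · apply Subtype.ext
      exact Fin.cons_self_tail v.1
    · rfl
  rw [Nat.card_congr e, Nat.card_sigma]

theorem wN_comp {L : ℕ} (c : Fin L → ℤ) (t : ℕ) (σ : Equiv.Perm (Fin L)) :
    wN (fun i => c (σ i)) t = wN c t := by
  unfold wN
  apply Nat.card_congr
  refine (Equiv.arrowCongr (Equiv.refl (Fin t)) σ).subtypeEquiv fun v => ?_
  rw [← σ.forall_congr_right (q := fun i => ((Finset.univ.filter fun j =>
    (Equiv.arrowCongr (Equiv.refl (Fin t)) σ) v j = i).card : ℤ) ≤ c i)]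
  refine forall_congr' fun i => ?_
  simp

theorem wN_neg {L : ℕ} (c : Fin L → ℤ) (t : ℕ) (i : Fin L) (h : c i < 0) : wN c t = 0 := by
  unfold wN
  rw [Nat.card_eq_zero]
  left
  refine ⟨fun v => ?_⟩
  have := v.2 i
  omega

theorem wN_zero {L : ℕ} (c : Fin L → ℤ) : wN c 0 = if ∀ i, 0 ≤ c i then 1 else 0 := by
  split_ifs with h
  · unfold wN
    rw [Nat.card_eq_one_iff_unique]
    refine ⟨⟨fun a b => Subtype.ext (Subsingleton.elim _ _)⟩, ⟨Fin.elim0, fun i => ?_⟩⟩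
    simpa using h i
  · push Not at h
    obtain ⟨i, hi⟩ := h
    exact wN_neg c 0 i hi

/-- the Jacobi-Trudi alternating sum -/
noncomputable def DD {L : ℕ} (α : Fin L → ℤ) (t : ℕ) : ℤ :=
  ∑ σ : Equiv.Perm (Fin L), ((Equiv.Perm.sign σ : ℤˣ) : ℤ) *
    (wN (fun i => α i - ((i : ℕ) : ℤ) + ((σ i : ℕ) : ℤ)) t : ℤ)

theorem DD_succ {L : ℕ} (α : Fin L → ℤ) (t : ℕ) :
    DD α (t + 1) = ∑ i, DD (fun k => α k - if k = i then 1 else 0) t := by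
  unfold DD
  rw [Finset.sum_comm]
  refine Finset.sum_congr rfl fun σ _ => ?_
  rw [← Finset.mul_sum, wN_succ]
  push_cast
  congr 1
  refine Finset.sum_congr rfl fun i _ => ?_
  congr 2
  funext k
  ring

theorem sum_sign_swap_zero {L : ℕ} (F : Equiv.Perm (Fin L) → ℤ) (a b : Fin L) (hab : a ≠ b)
    (h : ∀ σ, F (σ * Equiv.swap a b) = F σ) :
    ∑ σ : Equiv.Perm (Fin L), ((Equiv.Perm.sign σ : ℤˣ) : ℤ) * F σ = 0 := by
  have h1 : ∑ σ : Equiv.Perm (Fin L), ((Equiv.Perm.sign σ : ℤˣ) : ℤ) * F σ =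
      ∑ σ : Equiv.Perm (Fin L), ((Equiv.Perm.sign (σ * Equiv.swap a b) : ℤˣ) : ℤ) *
        F (σ * Equiv.swap a b) :=
    (Equiv.sum_comp (Equiv.mulRight (Equiv.swap a b))
      (fun σ : Equiv.Perm (Fin L) => ((Equiv.Perm.sign σ : ℤˣ) : ℤ) * F σ)).symm
  have h2 : ∑ σ : Equiv.Perm (Fin L), ((Equiv.Perm.sign (σ * Equiv.swap a b) : ℤˣ) : ℤ) *
        F (σ * Equiv.swap a b) = - ∑ σ : Equiv.Perm (Fin L), ((Equiv.Perm.sign σ : ℤˣ) : ℤ) * F σ := by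
    rw [← Finset.sum_neg_distrib]
    refine Finset.sum_congr rfl fun σ _ => ?_
    rw [h, Equiv.Perm.sign_mul, Equiv.Perm.sign_swap hab]
    simp
  omega

theorem DD_eq_zero {L : ℕ} (α : Fin L → ℤ) (t : ℕ) (a b : Fin L) (hab : a ≠ b)
    (h : α a - (a : ℕ) = α b - (b : ℕ)) : DD α t = 0 := by
  unfold DD
  refine sum_sign_swap_zero (fun σ => (wN (fun i => α i - ((i : ℕ) : ℤ) + ((σ i : ℕ) : ℤ)) t : ℤ))
    a b hab fun σ => ?_
  rw [← wN_comp (fun i => α i - ((i : ℕ) : ℤ) + ((σ i : ℕ) : ℤ)) t (Equiv.swap a b)]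
  congr 2
  funext i
  simp only [Equiv.Perm.mul_apply]
  congr 1
  rcases eq_or_ne i a with rfl | h1
  · rw [Equiv.swap_apply_left]; exact h
  rcases eq_or_ne i b with rfl | h2
  · rw [Equiv.swap_apply_right]; exact h.symm
  rw [Equiv.swap_apply_of_ne_of_ne h1 h2]

theorem DD_eq_zero_last {L : ℕ} (α : Fin L → ℤ) (t : ℕ) (a : Fin L) (ha : (a : ℕ) + 1 = L)
    (h : α a = -1) : DD α t = 0 := by
  unfold DD
  refine Finset.sum_eq_zero fun σ _ => ?_
  rw [wN_neg _ _ a]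
  · simp
  · rw [h]
    have := (σ a).2
    omega

theorem perm_eq_one_of_le {L : ℕ} (σ : Equiv.Perm (Fin L)) (h : ∀ i, i ≤ σ i) : σ = 1 := by
  have hs : ∑ i, ((σ i : Fin L) : ℕ) = ∑ i : Fin L, (i : ℕ) := Equiv.sum_comp σ fun i : Fin L => (i : ℕ)
  have := (Finset.sum_eq_sum_iff_of_le (s := Finset.univ) (f := fun i : Fin L => (i : ℕ))
    (g := fun i => ((σ i : Fin L) : ℕ)) fun i _ => Fin.le_def.1 (h i)).1 hs.symm
  ext i
  have := this i (Finset.mem_univ _)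
  simp [this.symm]

theorem DD_zero_one {L : ℕ} (α : Fin L → ℤ) (h0 : ∀ i, 0 ≤ α i) (h : ∀ i : Fin L, 0 < (i : ℕ) → α i = 0) :
    DD α 0 = 1 := by
  unfold DD
  rw [Finset.sum_eq_single 1]
  · rw [wN_zero, if_pos]
    · simp
    · intro i
      simpa using h0 i
  · intro σ _ hσ
    rw [wN_zero, if_neg]
    · simp
    · intro hc
      apply hσ
      apply perm_eq_one_of_le
      intro i
      rw [Fin.le_def]
      rcases Nat.eq_zero_or_pos (i : ℕ) with hi | hi
      · omega
      · have := hc i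
        rw [h i hi] at this
        omega
  · simp

theorem DD_zero_zero {L : ℕ} (α : Fin L → ℤ) (a b : Fin L) (ha : (a : ℕ) = 0) (hb : (b : ℕ) = 1)
    (h0 : 0 ≤ α a) (h1 : 1 ≤ α b) : DD α 0 = 0 := by
  unfold DD
  refine sum_sign_swap_zero (fun σ => (wN (fun i => α i - ((i : ℕ) : ℤ) + ((σ i : ℕ) : ℤ)) 0 : ℤ))
    a b (fun h => by rw [h] at ha; omega) fun σ => ?_
  rw [wN_zero, wN_zero]
  congr 2
  apply propext
  refine forall_congr' fun i => ?_
  rcases eq_or_ne i a with rfl | h2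
  · constructor <;> intro <;> omega
  rcases eq_or_ne i b with rfl | h3
  · constructor <;> intro <;> omega
  rw [Equiv.Perm.mul_apply, Equiv.swap_apply_of_ne_of_ne h2 h3]


theorem SYT_ext {μ : YoungDiagram} {Q Q' : SYT μ} (h : ∀ i j, Q.entry i j = Q'.entry i j) : Q = Q' := by
  cases Q; cases Q'
  congr
  funext i j
  exact h i j

theorem SYT_range {μ : YoungDiagram} (Q : SYT μ) {i j : ℕ} (h : (i, j) ∈ μ) :
    1 ≤ Q.entry i j ∧ Q.entry i j ≤ μ.card := by
  have := Q.bijOn.mapsTo (x := (i, j)) (by simpa using h)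
  simpa using this

theorem SYT_inj {μ : YoungDiagram} (Q : SYT μ) {i j i' j' : ℕ} (h : (i, j) ∈ μ) (h' : (i', j') ∈ μ)
    (he : Q.entry i j = Q.entry i' j') : i = i' ∧ j = j' := by
  have := Q.bijOn.injOn (x₁ := (i, j)) (x₂ := (i', j')) (by simpa using h) (by simpa using h') he
  simpa using this

theorem SYT_surj {μ : YoungDiagram} (Q : SYT μ) {k : ℕ} (h1 : 1 ≤ k) (h2 : k ≤ μ.card) :
    ∃ i j, (i, j) ∈ μ ∧ Q.entry i j = k := by
  obtain ⟨⟨i, j⟩, h, he⟩ := Q.bijOn.surjOn (a := k) (by simp; omega)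
  exact ⟨i, j, by simpa using h, he⟩

/-- building tableaux -/
def mkSYT (μ : YoungDiagram) (e : ℕ → ℕ → ℕ) (h0 : ∀ i j, (i, j) ∉ μ → e i j = 0)
    (hr : ∀ i j1 j2, j1 < j2 → (i, j2) ∈ μ → e i j1 < e i j2)
    (hc : ∀ i1 i2 j, i1 < i2 → (i2, j) ∈ μ → e i1 j < e i2 j)
    (h1 : ∀ i j, (i, j) ∈ μ → 1 ≤ e i j ∧ e i j ≤ μ.card)
    (h2 : ∀ i j i' j', (i, j) ∈ μ → (i', j') ∈ μ → e i j = e i' j' → i = i' ∧ j = j')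
    (h3 : ∀ k, 1 ≤ k → k ≤ μ.card → ∃ i j, (i, j) ∈ μ ∧ e i j = k) : SYT μ where
  entry := e
  entry_eq_zero := h0
  row_strict := hr
  col_strict := hc
  bijOn := by
    refine ⟨?_, ?_, ?_⟩
    · rintro ⟨i, j⟩ h
      have := h1 i j (by simpa using h)
      simpa using this
    · rintro ⟨i, j⟩ h ⟨i', j'⟩ h' he
      obtain ⟨rfl, rfl⟩ := h2 i j i' j' (by simpa using h) (by simpa using h') he
      rfl
    · intro k hk
      simp at hk
      obtain ⟨i, j, h, he⟩ := h3 k hk.1 hk.2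
      exact ⟨(i, j), by simpa using h, he⟩

instance SYTfinite (μ : YoungDiagram) : Finite (SYT μ) := by
  refine Finite.of_injective (β := μ.cells → Fin (μ.card + 1))
    (fun Q p => ⟨Q.entry p.1.1 p.1.2, ?_⟩) ?_
  · have := SYT_range Q (i := p.1.1) (j := p.1.2) (by have := p.2; simp)
    omega
  · intro Q Q' h
    apply SYT_ext
    intro i j
    by_cases hij : (i, j) ∈ μ
    · have := congrFun h ⟨(i, j), by simpa using hij⟩
      simpa using this
    · rw [Q.entry_eq_zero _ _ hij, Q'.entry_eq_zero _ _ hij]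

/-- first row contains `1..m` -/
def FR {μ : YoungDiagram} (m : ℕ) (Q : SYT μ) : Prop :=
  ∀ k, 1 ≤ k → k ≤ m → ∃ j, (0, j) ∈ μ ∧ Q.entry 0 j = k

theorem fSYTRow_eq (μ : YoungDiagram) (m : ℕ) : fSYTRow μ m = Nat.card {Q : SYT μ // FR m Q} := rfl

/-- remove the corner in row `i` -/
def remC (μ : YoungDiagram) (i : ℕ) (hi : μ.rowLen (i + 1) < μ.rowLen i) : YoungDiagram where
  cells := μ.cells.erase (i, μ.rowLen i - 1)
  isLowerSet := by
    rintro ⟨c, d⟩ ⟨a, b⟩ hle h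
    simp only [Finset.coe_erase, Set.mem_sdiff, Finset.mem_coe, YoungDiagram.mem_cells,
      Set.mem_singleton_iff, Prod.mk.injEq, Prod.mk_le_mk] at h hle ⊢
    refine ⟨μ.up_left_mem hle.1 hle.2 h.1, ?_⟩
    rintro ⟨rfl, rfl⟩
    have h1 := YoungDiagram.mem_iff_lt_rowLen.1 h.1
    rcases hle.1.eq_or_lt with h2 | h2
    · subst h2
      have := h.2
      omega
    · have := μ.rowLen_anti (a + 1) c h2
      omega

theorem mem_remC {μ : YoungDiagram} {i : ℕ} {hi : μ.rowLen (i + 1) < μ.rowLen i} {a b : ℕ} :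
    (a, b) ∈ remC μ i hi ↔ (a, b) ∈ μ ∧ ¬ (a = i ∧ b = μ.rowLen i - 1) := by
  rw [← YoungDiagram.mem_cells]
  change _ ∈ μ.cells.erase _ ↔ _
  rw [Finset.mem_erase, YoungDiagram.mem_cells]
  simp [and_comm]

theorem corner_mem {μ : YoungDiagram} {i : ℕ} (hi : μ.rowLen (i + 1) < μ.rowLen i) :
    (i, μ.rowLen i - 1) ∈ μ := by
  rw [YoungDiagram.mem_iff_lt_rowLen]; omega

theorem card_remC {μ : YoungDiagram} {i : ℕ} (hi : μ.rowLen (i + 1) < μ.rowLen i) :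
    (remC μ i hi).card + 1 = μ.card := by
  change (μ.cells.erase _).card + 1 = μ.cells.card
  apply Finset.card_erase_add_one
  simpa using corner_mem hi

theorem rowLen_remC {μ : YoungDiagram} {i : ℕ} (hi : μ.rowLen (i + 1) < μ.rowLen i) (k : ℕ) :
    ((remC μ i hi).rowLen k : ℤ) = μ.rowLen k - if k = i then 1 else 0 := by
  have h : ∀ b, b < (remC μ i hi).rowLen k ↔ b < μ.rowLen k ∧ ¬ (k = i ∧ b = μ.rowLen i - 1) := by
    intro b
    rw [← YoungDiagram.mem_iff_lt_rowLen, mem_remC, YoungDiagram.mem_iff_lt_rowLen]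
  split_ifs with hk
  · subst hk
    have h1 := h ((remC μ k hi).rowLen k)
    have h2 := h (μ.rowLen k - 1)
    have h3 := h (μ.rowLen k - 2)
    omega
  · have h1 := h ((remC μ i hi).rowLen k)
    have h2 := h (μ.rowLen k)
    omega

/-- restrict a tableau with maximal entry in a given corner -/
def restr {μ : YoungDiagram} {i : ℕ} (hi : μ.rowLen (i + 1) < μ.rowLen i) (Q : SYT μ)
    (hQ : Q.entry i (μ.rowLen i - 1) = μ.card) : SYT (remC μ i hi) :=
  have key : ∀ a b, (a, b) ∈ remC μ i hi → (a, b) ∈ μ ∧ ¬ (a = i ∧ b = μ.rowLen i - 1) :=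
    fun a b h => mem_remC.1 h
  mkSYT _ (fun a b => if a = i ∧ b = μ.rowLen i - 1 then 0 else Q.entry a b)
    (by
      intro a b h
      split_ifs with hc
      · rfl
      · exact Q.entry_eq_zero _ _ fun h' => h (mem_remC.2 ⟨h', hc⟩))
    (by
      intro a b c hbc h
      have h' := (remC μ i hi).up_left_mem (le_refl a) hbc.le h
      simp only [if_neg (key _ _ h).2, if_neg (key _ _ h').2]
      exact Q.row_strict _ _ _ hbc (key _ _ h).1)
    (by
      intro a b c hbc h
      have h' := (remC μ i hi).up_left_mem hbc.le (le_refl c) h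
      simp only [if_neg (key _ _ h).2, if_neg (key _ _ h').2]
      exact Q.col_strict _ _ _ hbc (key _ _ h).1)
    (by
      intro a b h
      simp only [if_neg (key _ _ h).2]
      have h1 := SYT_range Q (key _ _ h).1
      refine ⟨h1.1, ?_⟩
      have h2 : Q.entry a b ≠ μ.card := by
        rw [← hQ]
        intro he
        exact (key _ _ h).2 (SYT_inj Q (key _ _ h).1 (corner_mem hi) he)
      have := card_remC hi
      omega)
    (by
      intro a b a' b' h h'
      simp only [if_neg (key _ _ h).2, if_neg (key _ _ h').2]
      exact SYT_inj Q (key _ _ h).1 (key _ _ h').1)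
    (by
      intro k h1 h2
      have := card_remC hi
      obtain ⟨a, b, hab, he⟩ := SYT_surj Q h1 (by omega)
      have hne : ¬ (a = i ∧ b = μ.rowLen i - 1) := by
        rintro ⟨rfl, rfl⟩
        omega
      exact ⟨a, b, mem_remC.2 ⟨hab, hne⟩, by rw [if_neg hne, he]⟩)

/-- extend a tableau by the maximal entry in a given corner -/
def extd {μ : YoungDiagram} {i : ℕ} (hi : μ.rowLen (i + 1) < μ.rowLen i)
    (Q : SYT (remC μ i hi)) : SYT μ :=
  have hcr := card_remC hi
  mkSYT _ (fun a b => if a = i ∧ b = μ.rowLen i - 1 then μ.card else Q.entry a b)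
    (by
      intro a b h
      split_ifs with hc
      · obtain ⟨rfl, rfl⟩ := hc
        exact absurd (corner_mem hi) h
      · exact Q.entry_eq_zero _ _ fun h' => h (mem_remC.1 h').1)
    (by
      intro a b c hbc h
      have h' := μ.up_left_mem (le_refl a) hbc.le h
      have hlt := YoungDiagram.mem_iff_lt_rowLen.1 h
      have hb : ¬ (a = i ∧ b = μ.rowLen i - 1) := by
        rintro ⟨rfl, rfl⟩
        omega
      simp only [if_neg hb]
      split_ifs with hc
      · have := (SYT_range Q (mem_remC.2 ⟨h', hb⟩)).2
        omega
      · exact Q.row_strict _ _ _ hbc (mem_remC.2 ⟨h, hc⟩))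
    (by
      intro a b c hbc h
      have h' := μ.up_left_mem hbc.le (le_refl c) h
      have hlt := YoungDiagram.mem_iff_lt_rowLen.1 h
      have hb : ¬ (a = i ∧ c = μ.rowLen i - 1) := by
        rintro ⟨rfl, rfl⟩
        have := μ.rowLen_anti (a + 1) b hbc
        omega
      simp only [if_neg hb]
      split_ifs with hc
      · have := (SYT_range Q (mem_remC.2 ⟨h', hb⟩)).2
        omega
      · exact Q.col_strict _ _ _ hbc (mem_remC.2 ⟨h, hc⟩))
    (by
      intro a b h
      split_ifs with hc
      · omega
      · have := SYT_range Q (mem_remC.2 ⟨h, hc⟩)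
        omega)
    (by
      intro a b a' b' h h'
      split_ifs with hc hc' hc'
      · omega
      · have := SYT_range Q (mem_remC.2 ⟨h', hc'⟩)
        omega
      · have := SYT_range Q (mem_remC.2 ⟨h, hc⟩)
        omega
      · exact SYT_inj Q (mem_remC.2 ⟨h, hc⟩) (mem_remC.2 ⟨h', hc'⟩))
    (by
      intro k h1 h2
      rcases h2.eq_or_lt with h2 | h2
      · exact ⟨i, _, corner_mem hi, by rw [if_pos ⟨rfl, rfl⟩, h2]⟩
      · obtain ⟨a, b, hab, he⟩ := SYT_surj Q h1 (by omega)
        exact ⟨a, b, (mem_remC.1 hab).1, by rw [if_neg (mem_remC.1 hab).2, he]⟩)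

theorem restr_entry {μ : YoungDiagram} {i : ℕ} (hi : μ.rowLen (i + 1) < μ.rowLen i) (Q : SYT μ)
    (hQ : Q.entry i (μ.rowLen i - 1) = μ.card) (a b : ℕ) :
    (restr hi Q hQ).entry a b = if a = i ∧ b = μ.rowLen i - 1 then 0 else Q.entry a b := rfl

theorem extd_entry {μ : YoungDiagram} {i : ℕ} (hi : μ.rowLen (i + 1) < μ.rowLen i)
    (Q : SYT (remC μ i hi)) (a b : ℕ) :
    (extd hi Q).entry a b = if a = i ∧ b = μ.rowLen i - 1 then μ.card else Q.entry a b := rfl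

theorem card_restr {μ : YoungDiagram} {i : ℕ} (hi : μ.rowLen (i + 1) < μ.rowLen i) (m : ℕ)
    (hm : m < μ.card) :
    Nat.card {Q : SYT μ // FR m Q ∧ Q.entry i (μ.rowLen i - 1) = μ.card} =
      Nat.card {Q : SYT (remC μ i hi) // FR m Q} := by
  apply Nat.card_congr
  refine ⟨fun Q => ⟨restr hi Q.1 Q.2.2, ?_⟩, fun Q => ⟨extd hi Q.1, ?_, ?_⟩, fun Q => ?_, fun Q => ?_⟩
  · intro k h1 h2
    obtain ⟨j, hj, he⟩ := Q.2.1 k h1 h2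
    have hne : ¬ (0 = i ∧ j = μ.rowLen i - 1) := by
      rintro ⟨h3, h4⟩
      have h5 := Q.2.2
      have h6 : Q.1.entry i (μ.rowLen i - 1) = Q.1.entry 0 j :=
        congrArg₂ Q.1.entry h3.symm h4.symm
      omega
    exact ⟨j, mem_remC.2 ⟨hj, hne⟩, by rw [restr_entry, if_neg hne, he]⟩
  · intro k h1 h2
    obtain ⟨j, hj, he⟩ := Q.2 k h1 h2
    exact ⟨j, (mem_remC.1 hj).1, by rw [extd_entry, if_neg (mem_remC.1 hj).2, he]⟩
  · rw [extd_entry, if_pos ⟨rfl, rfl⟩]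
  · apply Subtype.ext
    apply SYT_ext
    intro a b
    rw [extd_entry, restr_entry]
    split_ifs with h
    · rw [h.1, h.2]; exact Q.2.2.symm
    · rfl
  · apply Subtype.ext
    apply SYT_ext
    intro a b
    rw [restr_entry, extd_entry]
    split_ifs with h
    · rw [h.1, h.2]
      exact (Q.1.entry_eq_zero _ _ fun h' => (mem_remC.1 h').2 ⟨rfl, rfl⟩).symm
    · rfl

theorem exists_corner {μ : YoungDiagram} (Q : SYT μ) (h : 0 < μ.card) :
    ∃ i, μ.rowLen (i + 1) < μ.rowLen i ∧ Q.entry i (μ.rowLen i - 1) = μ.card := by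
  obtain ⟨i, j, hij, he⟩ := SYT_surj Q h le_rfl
  have h1 : (i, j + 1) ∉ μ := by
    intro h'
    have := Q.row_strict i j (j + 1) (by omega) h'
    have := SYT_range Q h'
    omega
  have h2 : (i + 1, j) ∉ μ := by
    intro h'
    have := Q.col_strict i (i + 1) j (by omega) h'
    have := SYT_range Q h'
    omega
  rw [YoungDiagram.mem_iff_lt_rowLen] at h1 h2 hij
  have : μ.rowLen i - 1 = j := by omega
  exact ⟨i, by omega, by rw [this, he]⟩

theorem card_FR_succ {μ : YoungDiagram} {L : ℕ} (hL : ∀ i, L ≤ i → μ.rowLen i = 0) (m : ℕ)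
    (hm : m < μ.card) :
    Nat.card {Q : SYT μ // FR m Q} = ∑ i : Fin L,
      if hi : μ.rowLen (i + 1) < μ.rowLen i then Nat.card {Q : SYT (remC μ i hi) // FR m Q} else 0 := by
  have hex : ∀ Q : {Q : SYT μ // FR m Q}, ∃ i : Fin L, μ.rowLen (i + 1) < μ.rowLen i ∧
      Q.1.entry i (μ.rowLen i - 1) = μ.card := by
    intro Q
    obtain ⟨i, h1, h2⟩ := exists_corner Q.1 (by omega)
    have : i < L := by
      by_contra hc
      have := hL i (by omega)
      omega
    exact ⟨⟨i, this⟩, h1, h2⟩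
  choose f hf1 hf2 using hex
  rw [← Nat.card_congr (Equiv.sigmaFiberEquiv f), Nat.card_sigma]
  refine Finset.sum_congr rfl fun i _ => ?_
  split_ifs with hi
  · rw [← card_restr hi m hm]
    apply Nat.card_congr
    refine ⟨fun Q => ⟨Q.1.1, Q.1.2, by have := hf2 Q.1; rw [Q.2] at this; exact this⟩,
      fun Q => ⟨⟨Q.1, Q.2.1⟩, ?_⟩, fun Q => rfl, fun Q => rfl⟩
    have h2 := hf2 ⟨Q.1, Q.2.1⟩
    have := SYT_inj Q.1 (corner_mem (hf1 ⟨Q.1, Q.2.1⟩)) (corner_mem hi) (h2.trans Q.2.2.symm)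
    exact Fin.ext this.1
  · rw [Nat.card_eq_zero]
    left
    refine ⟨fun Q => hi ?_⟩
    have := hf1 Q.1
    rw [Q.2] at this
    exact this

theorem card_eq_sum_rowLen {μ : YoungDiagram} {L : ℕ} (hL : ∀ i, L ≤ i → μ.rowLen i = 0) :
    μ.card = ∑ i : Fin L, μ.rowLen i := by
  rw [Fin.sum_univ_eq_sum_range (fun i => μ.rowLen i)]
  change μ.cells.card = _
  rw [Finset.card_eq_sum_card_fiberwise (f := Prod.fst) (t := Finset.range L)]
  · refine Finset.sum_congr rfl fun i _ => ?_
    rw [YoungDiagram.rowLen_eq_card]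
    rfl
  · rintro ⟨i, j⟩ h
    simp only [Finset.mem_coe, YoungDiagram.mem_cells, YoungDiagram.mem_iff_lt_rowLen] at h
    simp only [Finset.coe_range, Set.mem_Iio]
    by_contra hc
    have := hL i (by omega)
    omega

theorem card_FR_two {μ : YoungDiagram} (h : 0 < μ.rowLen 1) :
    Nat.card {Q : SYT μ // FR μ.card Q} = 0 := by
  rw [Nat.card_eq_zero]
  left
  refine ⟨fun Q => ?_⟩
  have hm : (1, 0) ∈ μ := YoungDiagram.mem_iff_lt_rowLen.2 h
  have hr := SYT_range Q.1 hm
  obtain ⟨j, hj, he⟩ := Q.2 _ hr.1 hr.2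
  have := (SYT_inj Q.1 hj hm he).1
  omega

theorem card_FR_one {μ : YoungDiagram} (h : μ.rowLen 1 = 0) :
    Nat.card {Q : SYT μ // FR μ.card Q} = 1 := by
  have hz : ∀ i j, (i, j) ∈ μ ↔ i = 0 ∧ j < μ.card := by
    have hc : μ.card = μ.rowLen 0 := by
      have := card_eq_sum_rowLen (μ := μ) (L := 1) (fun i hi => by
        have := μ.rowLen_anti 1 i hi
        omega)
      simpa using this
    intro i j
    rw [YoungDiagram.mem_iff_lt_rowLen, hc]
    rcases Nat.eq_zero_or_pos i with rfl | hi
    · simp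
    · have := μ.rowLen_anti 1 i hi
      omega
  rw [Nat.card_eq_one_iff_unique]
  constructor
  · refine ⟨fun Q Q' => Subtype.ext (SYT_ext ?_)⟩
    have key : ∀ (Q : SYT μ) d j, j + d + 1 = μ.card → Q.entry 0 j ≤ j + 1 := by
      intro Q d
      induction d with
      | zero =>
        intro j hj
        have := (SYT_range Q ((hz 0 j).2 ⟨rfl, by omega⟩)).2
        omega
      | succ d ih =>
        intro j hj
        have h1 := ih (j + 1) (by omega)
        have h2 := Q.row_strict 0 j (j + 1) (by omega) ((hz 0 (j + 1)).2 ⟨rfl, by omega⟩)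
        omega
    have key2 : ∀ (Q : SYT μ) j, j < μ.card → j + 1 ≤ Q.entry 0 j := by
      intro Q j
      induction j with
      | zero => intro hj; exact (SYT_range Q ((hz 0 0).2 ⟨rfl, by omega⟩)).1
      | succ j ih =>
        intro hj
        have h1 := ih (by omega)
        have h2 := Q.row_strict 0 j (j + 1) (by omega) ((hz 0 (j + 1)).2 ⟨rfl, by omega⟩)
        omega
    intro i j
    by_cases hij : (i, j) ∈ μ
    · obtain ⟨rfl, hj⟩ := (hz i j).1 hij
      have a1 := key Q.1 (μ.card - 1 - j) j (by omega)
      have a2 := key2 Q.1 j hj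
      have b1 := key Q'.1 (μ.card - 1 - j) j (by omega)
      have b2 := key2 Q'.1 j hj
      omega
    · rw [Q.1.entry_eq_zero _ _ hij, Q'.1.entry_eq_zero _ _ hij]
  · have e : ∀ i j, (i, j) ∈ μ → (if (i, j) ∈ μ then j + 1 else 0) = j + 1 := fun i j h => if_pos h
    refine ⟨mkSYT μ (fun i j => if (i, j) ∈ μ then j + 1 else 0) (fun i j h => if_neg h) ?_ ?_ ?_ ?_ ?_, ?_⟩
    · intro i a b hab hb
      simp only [if_pos hb, if_pos (μ.up_left_mem (le_refl i) hab.le hb)]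
      omega
    · intro a b c hab hb
      have := (hz _ _).1 hb
      omega
    · intro i j hij
      have := (hz _ _).1 hij
      simp only [if_pos hij]
      omega
    · intro i j i' j' h h'
      have := (hz _ _).1 h
      have := (hz _ _).1 h'
      simp only [if_pos h, if_pos h']
      omega
    · intro k h1 h2
      have : (0, k - 1) ∈ μ := (hz _ _).2 ⟨rfl, by omega⟩
      exact ⟨0, k - 1, this, by rw [if_pos this]; omega⟩
    · intro k h1 h2
      have : (0, k - 1) ∈ μ := (hz _ _).2 ⟨rfl, by omega⟩
      refine ⟨k - 1, this, ?_⟩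
      change (if (0, k - 1) ∈ μ then k - 1 + 1 else 0) = k
      rw [if_pos this]; omega

theorem fSYTRow_eq_DD (t : ℕ) : ∀ (μ : YoungDiagram) (L : ℕ), (∀ i, L ≤ i → μ.rowLen i = 0) →
    t ≤ μ.card → (fSYTRow μ (μ.card - t) : ℤ) = DD (fun i : Fin L => (μ.rowLen i : ℤ)) t := by
  induction t with
  | zero =>
    intro μ L hL _
    rw [fSYTRow_eq, Nat.sub_zero]
    rcases Nat.eq_zero_or_pos (μ.rowLen 1) with h | h
    · rw [card_FR_one h, DD_zero_one]
      · rfl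
      · intro i; positivity
      · intro i hi
        have := μ.rowLen_anti 1 i hi
        have : μ.rowLen i = 0 := by omega
        simp [this]
    · rw [card_FR_two h]
      have : 1 < L := by
        by_contra hc
        have := hL 1 (by omega)
        omega
      rw [DD_zero_zero _ ⟨0, by omega⟩ ⟨1, this⟩ rfl rfl (by positivity)
        (by simp only; omega)]
      rfl
  | succ t ih =>
    intro μ L hL ht
    rw [fSYTRow_eq, card_FR_succ hL _ (by omega), DD_succ]
    push_cast
    refine Finset.sum_congr rfl fun i _ => ?_
    split_ifs with hi
    · rw [← fSYTRow_eq]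
      have hc := card_remC hi
      have : μ.card - (t + 1) = (remC μ i hi).card - t := by omega
      rw [this, ih (remC μ i hi) L ?_ (by omega)]
      · congr 1
        funext k
        rw [rowLen_remC hi k]
        simp only [Fin.ext_iff]
      · intro k hk
        have h1 := rowLen_remC hi k
        rw [hL k hk] at h1
        split_ifs at h1 <;> omega
    · symm
      have heq : μ.rowLen (i + 1) = μ.rowLen i := by
        have := μ.rowLen_anti i (i + 1) (by omega)
        omega
      by_cases h : (i : ℕ) + 1 < L
      · apply DD_eq_zero _ _ i ⟨i + 1, h⟩
        · simp [Fin.ext_iff]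
        · have : (⟨i + 1, h⟩ : Fin L) ≠ i := by simp [Fin.ext_iff]
          simp only [if_neg this, heq]
          simp
          omega
      · apply DD_eq_zero_last _ _ i (by have := i.2; omega)
        have := hL (i + 1) (by omega)
        simp only [if_true]
        rw [← heq, this]
        simp

theorem rowLens_zero (μ : YoungDiagram) (i : ℕ) (h : μ.rowLens.length ≤ i) : μ.rowLen i = 0 := by
  rw [YoungDiagram.length_rowLens] at h
  by_contra hc
  have : (i, 0) ∈ μ := YoungDiagram.mem_iff_lt_rowLen.2 (by omega)
  rw [YoungDiagram.mem_iff_lt_colLen] at this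
  omega

theorem sum_fix_chi {n : ℕ} {μ : YoungDiagram} (hμ : μ.card = n) (t : ℕ) (ht : t ≤ n) :
    ∑ g : Equiv.Perm (Fin n), (Nat.card {u : Fin t ↪ Fin n // ∀ i, g (u i) = u i} : ℤ) * chi n μ g⁻¹ =
      (fSYTRow μ (n - t) : ℤ) * n.factorial := by
  have h1 := fSYTRow_eq_DD t μ μ.rowLens.length (rowLens_zero μ) (by omega)
  rw [hμ] at h1
  rw [h1]
  unfold DD chi
  simp only [Finset.mul_sum]
  rw [Finset.sum_comm, Finset.sum_mul]
  refine Finset.sum_congr rfl fun σ _ => ?_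
  have hs : ∑ i : Fin μ.rowLens.length,
      (((μ.rowLen (i : ℕ) : ℕ) : ℤ) - ((i : ℕ) : ℤ) + ((σ i : ℕ) : ℤ)) = n := by
    rw [Finset.sum_add_distrib, Finset.sum_sub_distrib,
      Equiv.sum_comp σ (fun i => ((i : ℕ) : ℤ)), sub_add_cancel, ← hμ,
      card_eq_sum_rowLen (rowLens_zero μ)]
    push_cast
    rfl
  have hb := burnside_YX (t := t) hs
  rw [mul_assoc]
  have hb' := congrArg (Nat.cast : ℕ → ℤ) hb.symm
  rw [Nat.cast_mul, Nat.cast_sum] at hb'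
  rw [hb']
  push_cast
  rw [Finset.mul_sum]
  refine Finset.sum_congr rfl fun g _ => ?_
  ring


theorem card_colors (N r t : ℕ) [NeZero r] (ht : t ≤ N) :
    Nat.card {c : Fin N → ZMod r // ∀ k : Fin N, (k : ℕ) < N - t → c k = 0} = r ^ t := by
  have h : ∀ c : Fin N → ZMod r, (∀ k : Fin N, (k : ℕ) < N - t → c k = 0) ↔
      c ∈ Fintype.piFinset (fun k : Fin N => if (k : ℕ) < N - t then ({0} : Finset (ZMod r))
        else Finset.univ) := by
    intro c
    rw [Fintype.mem_piFinset]
    refine forall_congr' fun k => ?_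
    split_ifs with hk <;> simp [hk]
  rw [Nat.card_congr (Equiv.subtypeEquivRight h), Nat.card_eq_fintype_card, Fintype.card_coe,
    Fintype.card_piFinset]
  have h2 : ∀ k : Fin N, (if (k : ℕ) < N - t then ({0} : Finset (ZMod r)) else Finset.univ).card =
      if (k : ℕ) < N - t then 1 else r := by
    intro k
    split_ifs <;> simp [ZMod.card]
  simp only [h2]
  rw [Fin.prod_univ_eq_prod_range (fun k => if k < N - t then 1 else r)]
  have : Finset.range N = Finset.range ((N - t) + t) := by congr 1; omega
  rw [this, Finset.prod_range_add]
  rw [Finset.prod_congr rfl (g := fun _ => 1) (fun x hx => if_pos (Finset.mem_range.1 hx)),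
    Finset.prod_congr rfl (g := fun _ => r) (fun x hx => if_neg (by omega))]
  simp

theorem card_colored {n r t : ℕ} [NeZero r] {μ : YoungDiagram} (hμ : μ.card = n) (ht : t ≤ n) :
    Nat.card {p : SYT μ × (Fin μ.card → ZMod r) // zeroFirstRow p.1 p.2 (n - t)} =
      r ^ t * fSYTRow μ (n - t) := by
  subst hμ
  rw [← card_colors μ.card r t ht, fSYTRow_eq, mul_comm, ← Nat.card_prod]
  apply Nat.card_congr
  refine ⟨fun p => ⟨⟨p.1.1, fun k h1 h2 => ?_⟩, ⟨p.1.2, fun k hk => (p.2 k hk).2⟩⟩,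
    fun q => ⟨(q.1.1, q.2.1), fun k hk => ⟨?_, q.2.2 k hk⟩⟩, fun p => rfl, fun q => rfl⟩
  · have := (p.2 ⟨k - 1, by omega⟩ (by simp only; omega)).1
    simp only at this
    rwa [Nat.sub_add_cancel h1] at this
  · exact q.1.2 _ (by omega) (by omega)

theorem sum_powerset_max (S : Finset ℕ) (F : Finset ℕ → ℤ) :
    ∑ T ∈ S.powerset, F T = F ∅ + ∑ s ∈ S, ∑ T ∈ (S.filter (· < s)).powerset, F (insert s T) := by
  induction S using Finset.induction_on_max with
  | empty => simp
  | insert m U hm ih =>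
    have hmU : m ∉ U := fun h => lt_irrefl _ (hm m h)
    rw [Finset.sum_powerset_insert hmU, ih, Finset.sum_insert hmU]
    have e1 : (insert m U).filter (· < m) = U := by
      rw [Finset.filter_insert, if_neg (lt_irrefl _), Finset.filter_true_of_mem hm]
    have e2 : ∀ s ∈ U, (insert m U).filter (· < s) = U.filter (· < s) := by
      intro s hs
      rw [Finset.filter_insert, if_neg (not_lt.2 (hm s hs).le)]
    have e3 : ∑ s ∈ U, ∑ T ∈ ((insert m U).filter (· < s)).powerset, F (insert s T) =
        ∑ s ∈ U, ∑ T ∈ (U.filter (· < s)).powerset, F (insert s T) :=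
      Finset.sum_congr rfl fun s hs => by rw [e2 s hs]
    rw [e1, e3]
    ring

theorem card_split (S : Finset ℕ) (s : ℕ) (hs : s ∈ S) :
    S.card = (S.filter (· < s)).card + 1 + (S.filter (s < ·)).card := by
  have h1 := Finset.card_filter_add_card_filter_not (s := S) (· < s)
  have h2 : S.filter (fun x => ¬ x < s) = insert s (S.filter (s < ·)) := by
    ext x
    simp only [Finset.mem_filter, Finset.mem_insert]
    constructor
    · rintro ⟨h, h'⟩
      rcases (not_lt.1 h').eq_or_lt with h3 | h3
      · exact Or.inl h3.symm
      · exact Or.inr ⟨h, h3⟩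
    · rintro (rfl | ⟨h, h'⟩)
      · exact ⟨hs, lt_irrefl _⟩
      · exact ⟨h, by omega⟩
  rw [h2, Finset.card_insert_of_notMem (by simp)] at h1
  omega

theorem lhs_eq {n r : ℕ} [NeZero r] {μ : YoungDiagram} (hμ : μ.card = n) (S : Finset ℕ)
    (hS : S ⊆ Finset.Icc 1 (n - 1)) (wS : Equiv.Perm (Fin n)) (hwS : descentSet wS = S)
    (hwSmax : ∀ v : Equiv.Perm (Fin n), descentSet v = S → invCount v ≤ invCount wS) :
    (∑ g : Equiv.Perm (Fin n), cBeta n r S g * chi n μ g⁻¹) =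
      (∑ s ∈ insert 0 S, (-1 : ℤ) ^ (S.filter (s < ·)).card * ((dset S wS s).card : ℤ) *
        ((r : ℤ) ^ s * fSYTRow μ (n - s))) * n.factorial := by
  have h1 : ∑ g : Equiv.Perm (Fin n), cBeta n r S g * chi n μ g⁻¹ =
      ∑ T ∈ S.powerset, (-1 : ℤ) ^ (S.card - T.card) *
        ∑ g : Equiv.Perm (Fin n), cAlpha n r T g * chi n μ g⁻¹ := by
    simp only [Finset.mul_sum]
    rw [Finset.sum_comm]
    refine Finset.sum_congr rfl fun g _ => ?_
    unfold cBeta gBeta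
    rw [Finset.sum_mul]
    refine Finset.sum_congr rfl fun T _ => ?_
    unfold cAlpha
    ring
  have h0S : 0 ∉ S := fun h => by have := Finset.mem_Icc.1 (hS h); omega
  rw [h1, sum_powerset_max, Finset.sum_insert h0S, add_mul, Finset.sum_mul]
  congr 1
  · have e : S.filter (0 < ·) = S := Finset.filter_true_of_mem fun x hx => by
      have := Finset.mem_Icc.1 (hS hx); omega
    have h2 := sum_fix_chi hμ 0 (Nat.zero_le _)
    simp only [cAlpha_empty]
    have e0 : ∀ g : Equiv.Perm (Fin n), Nat.card {u : Fin 0 ↪ Fin n // ∀ i, g (u i) = u i} = 1 := by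
      intro g
      rw [Nat.card_eq_one_iff_unique]
      refine ⟨⟨fun a b => Subtype.ext (Function.Embedding.ext fun i => i.elim0)⟩,
        ⟨⟨⟨Fin.elim0, fun i => i.elim0⟩, fun i => i.elim0⟩⟩⟩
    simp only [e0, Nat.cast_one] at h2
    rw [h2, e, card_dset_zero S wS hwS]
    simp
    ring
  · refine Finset.sum_congr rfl fun s hs => ?_
    have hsn := Finset.mem_Icc.1 (hS hs)
    rw [card_dset S hS wS hwS hwSmax s hs, Finset.mul_sum, Finset.sum_mul, Finset.sum_mul]
    refine Finset.sum_congr rfl fun T hT => ?_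
    have hT' : ∀ x ∈ T, 0 < x ∧ x < s := by
      intro x hx
      have h3 := Finset.mem_filter.1 (Finset.mem_powerset.1 hT hx)
      have := Finset.mem_Icc.1 (hS h3.1)
      exact ⟨by omega, h3.2⟩
    have hsT : s ∉ T := fun h => lt_irrefl _ (hT' s h).2
    have h4 : ∑ g : Equiv.Perm (Fin n), cAlpha n r (insert s T) g * chi n μ g⁻¹ =
        (chM T s : ℤ) * r ^ s * ((fSYTRow μ (n - s) : ℤ) * n.factorial) := by
      rw [← sum_fix_chi hμ s (by omega), Finset.mul_sum]
      refine Finset.sum_congr rfl fun g _ => ?_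
      rw [cAlpha_insert T s hT' (by omega) (by omega)]
      ring
    rw [h4, Finset.card_insert_of_notMem hsT]
    have h5 := card_split S s hs
    have h6 := Finset.card_le_card (Finset.mem_powerset.1 hT)
    have h7 : S.card - (T.card + 1) = (S.filter (s < ·)).card + ((S.filter (· < s)).card - T.card) := by
      omega
    rw [h7, pow_add]
    ring

theorem rhs_eq {n r : ℕ} [NeZero r] {μ : YoungDiagram} (hμ : μ.card = n) (S : Finset ℕ)
    (hS : S ⊆ Finset.Icc 1 (n - 1)) (wS : Equiv.Perm (Fin n)) :
    (Nat.card {p : Equiv.Perm (Fin n) × SYT μ × (Fin μ.card → ZMod r) //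
          descentSet p.1 = S ∧ Odd (ctau n S wS p.1 p.2.1 p.2.2)} : ℤ) =
      ∑ s ∈ insert 0 S, (-1 : ℤ) ^ (S.filter (s < ·)).card * ((dset S wS s).card : ℤ) *
        ((r : ℤ) ^ s * fSYTRow μ (n - s)) := by
  let _ : Fintype (SYT μ) := Fintype.ofFinite _
  rw [Nat.card_eq_fintype_card, Fintype.card_subtype, Finset.card_filter]
  push_cast
  rw [Fintype.sum_prod_type]
  have h1 : ∀ (w : Equiv.Perm (Fin n)) (x : SYT μ × (Fin μ.card → ZMod r)),
      (if descentSet w = S ∧ Odd (ctau n S wS w x.1 x.2) then (1 : ℤ) else 0) =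
      ∑ s ∈ insert 0 S, (-1 : ℤ) ^ (S.filter (s < ·)).card *
        ((if descentSet w = S ∧ ∀ x : Fin n, s ≤ x → w x = wS x then 1 else 0) *
          (if zeroFirstRow x.1 x.2 (n - s) then 1 else 0)) := by
    intro w x
    by_cases hd : descentSet w = S
    · simp only [hd, true_and]
      rw [ctau_odd S hS]
      refine Finset.sum_congr rfl fun s _ => ?_
      congr 1
      by_cases ha : ∀ x : Fin n, s ≤ x → w x = wS x
      · rw [if_pos ha, one_mul]
        by_cases hz : zeroFirstRow x.1 x.2 (n - s)
        · rw [if_pos ⟨ha, hz⟩, if_pos hz]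
        · rw [if_neg fun h => hz h.2, if_neg hz]
      · rw [if_neg ha, if_neg fun h => ha h.1, zero_mul]
    · simp [hd]
  simp only [h1]
  simp only [Finset.sum_comm (s := Finset.univ) (t := insert 0 S), ← Finset.mul_sum, ← Finset.sum_mul]
  refine Finset.sum_congr rfl fun s hs => ?_
  have hsn : s ≤ n := by
    rcases Finset.mem_insert.1 hs with rfl | hs
    · omega
    · have := Finset.mem_Icc.1 (hS hs); omega
  have h2 := card_colored (r := r) hμ hsn
  rw [Nat.card_eq_fintype_card, Fintype.card_subtype, Finset.card_filter] at h2
  have h3 := congrArg (Nat.cast : ℕ → ℤ) h2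
  push_cast at h3
  rw [h3, mul_assoc]
  congr 2
  unfold dset
  rw [Finset.card_filter]
  push_cast
  rfl

/-- **Theorem 4.1(a)**: `b_{r,λ}(S)` equals the number of pairs `(w,Q)` with `w ∈ 𝔖_n`
of descent set `S` and `Q` an `r`-colored standard Young tableau of shape `λ` with
`τ(w,Q)` odd. -/
theorem statement10 (n r : ℕ) (hn : 0 < n) (hr : 0 < r) (μ : YoungDiagram)
    (hμ : μ.card = n) (S : Finset ℕ) (hS : S ⊆ Finset.Icc 1 (n - 1))
    (wS : Equiv.Perm (Fin n)) (hwS : descentSet wS = S)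
    (hwSmax : ∀ v : Equiv.Perm (Fin n), descentSet v = S → invCount v ≤ invCount wS) :
    (∑ g : Equiv.Perm (Fin n), cBeta n r S g * chi n μ g⁻¹) =
      (Nat.card {p : Equiv.Perm (Fin n) × SYT μ × (Fin μ.card → ZMod r) //
          descentSet p.1 = S ∧ Odd (ctau n S wS p.1 p.2.1 p.2.2)} : ℤ) *
        (n.factorial : ℤ) := by
  have : NeZero r := ⟨hr.ne'⟩
  rw [lhs_eq hμ S hS wS hwS hwSmax, rhs_eq hμ S hS wS]
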